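/- arXiv:2409.17551 — 4 statements merged into one kernel-verified Lean document; each statement's English description precedes it below -/
import Mathlib

section
/- Let k be a field, let (R, m) and (S, n) be standard graded k-algebras with m ≠ (0) and n ≠ (0), let I ⊆ m² and J ⊆ n² be homogeneous ideals, let T = R ⊗_k S, and let F = I + J + mn ⊆ T. Then depth(T/F) = min{1, depth(R/I), depth(S/J)}. -/
/- STATEMENT 5: Let k be a field, (R, m) and (S, n) standard graded k-algebras with
m ≠ 0 and n ≠ 0, I ⊆ m² and J ⊆ n² homogeneous ideals, T = R ⊗_k S, and
F = I + J + mn ⊆ T. Then depth(T/F) = min{1, depth(R/I), depth(S/J)}, where depth is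
the common length of maximal regular sequences in the graded maximal ideal. -/

open TensorProduct

noncomputable section

/-- Depth of a module `M` with respect to an ideal `p`: the supremum of the lengths of
`M`-regular sequences consisting of elements of `p`. -/
def seqDepth {A : Type*} [CommRing A] (p : Ideal A) (M : Type*) [AddCommGroup M]
    [Module A M] : ℕ :=
  sSup {l : ℕ | ∃ rs : List A, rs.length = l ∧ (∀ r ∈ rs, r ∈ p) ∧
    RingTheory.Sequence.IsRegular M rs}

open RingTheory.Sequence

section Depth

/-- A weakly `M`-regular sequence `rs` is no longer than the height of any prime containing the
annihilator of `M ⧸ rs M`. -/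
theorem RingTheory.Sequence.IsWeaklyRegular.length_le_height {A M : Type*} [CommRing A]
    [AddCommGroup M] [Module A M] {rs : List A} (h : IsWeaklyRegular M rs) (Q : Ideal A)
    [Q.IsPrime]
    (hQ : Module.annihilator A (M ⧸ (Ideal.ofList rs • ⊤ : Submodule A M)) ≤ Q) :
    (rs.length : ℕ∞) ≤ Q.height := by
  induction rs using List.reverseRecOn generalizing Q with
  | nil => simp
  | append_singleton rs r ih =>
    rw [isWeaklyRegular_append_iff, isWeaklyRegular_singleton_iff] at h
    have hle : (Ideal.ofList rs • ⊤ : Submodule A M) ≤ Ideal.ofList (rs ++ [r]) • ⊤ :=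
      Submodule.smul_mono_left (by simp)
    have hann : Module.annihilator A (M ⧸ (Ideal.ofList rs • ⊤ : Submodule A M)) ≤
        Module.annihilator A (M ⧸ (Ideal.ofList (rs ++ [r]) • ⊤ : Submodule A M)) :=
      LinearMap.annihilator_le_of_surjective (Submodule.factor hle)
        (Submodule.factor_surjective hle)
    obtain ⟨P, hP, hPQ⟩ := Ideal.exists_minimalPrimes_le (hann.trans hQ)
    have := hP.isPrime
    have hrP : r ∉ P := h.2.notMem_of_mem_minimalPrimes hP
    have hrQ : r ∈ Q := by
      apply hQ
      rw [Module.mem_annihilator]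
      intro x
      obtain ⟨x, rfl⟩ := Submodule.Quotient.mk_surjective _ x
      rw [← Submodule.Quotient.mk_smul, Submodule.Quotient.mk_eq_zero]
      exact Submodule.smul_mem_smul (by simp [Ideal.mem_sup_right]) trivial
    have hlt : P < Q := lt_of_le_of_ne hPQ fun e => hrP (e ▸ hrQ)
    calc ((rs ++ [r]).length : ℕ∞) = rs.length + 1 := by simp
      _ ≤ P.height + 1 := by gcongr; exact ih h.1 P hP.le
      _ ≤ Q.height := Ideal.height_add_one_le_of_lt_of_isPrime hlt

theorem mem_of_mk_mem_smul_top {A : Type*} [CommRing A] {I p : Ideal A} (hI : I ≤ p) {x : A}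
    (hx : Submodule.Quotient.mk x ∈ (p • ⊤ : Submodule A (A ⧸ I))) : x ∈ p := by
  have h : (p • ⊤ : Submodule A (A ⧸ I)).map (Submodule.factor hI) ≤ ⊥ := by
    rw [Submodule.map_smul'', Submodule.smul_le]
    intro a ha y _
    obtain ⟨y, rfl⟩ := Submodule.Quotient.mk_surjective _ y
    rw [← Submodule.Quotient.mk_smul, Submodule.mem_bot, Submodule.Quotient.mk_eq_zero]
    exact p.mul_mem_right _ ha
  exact (Submodule.Quotient.mk_eq_zero p).1 (h (Submodule.mem_map_of_mem hx))

theorem smul_top_quotient_ne_top {A : Type*} [CommRing A] {I p : Ideal A} (hI : I ≤ p)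
    (hp : p ≠ ⊤) : (p • ⊤ : Submodule A (A ⧸ I)) ≠ ⊤ := fun h =>
  hp <| (Ideal.eq_top_iff_one _).2 <| mem_of_mk_mem_smul_top hI <| by rw [h]; trivial

theorem bddAbove_length_isRegular_quotient {A : Type*} [CommRing A] [IsNoetherianRing A]
    {I p : Ideal A} [p.IsPrime] (hI : I ≤ p) :
    BddAbove {l : ℕ | ∃ rs : List A, rs.length = l ∧ (∀ r ∈ rs, r ∈ p) ∧
      IsRegular (A ⧸ I) rs} := by
  obtain ⟨N, hN⟩ := ENat.ne_top_iff_exists.1 (Ideal.height_ne_top_of_isPrime (I := p))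
  refine ⟨N, ?_⟩
  rintro _ ⟨rs, rfl, hrs, h⟩
  rw [← Nat.cast_le (α := ℕ∞), hN]
  refine h.toIsWeaklyRegular.length_le_height p fun x hx => mem_of_mk_mem_smul_top hI ?_
  rw [Module.mem_annihilator] at hx
  have h1 := hx (Submodule.Quotient.mk (Submodule.Quotient.mk 1))
  rw [← Submodule.Quotient.mk_smul, Submodule.Quotient.mk_eq_zero, ← Submodule.Quotient.mk_smul,
    smul_eq_mul, mul_one] at h1
  exact Submodule.smul_mono_left (Ideal.span_le.2 hrs) h1

theorem one_le_seqDepth_iff {A M : Type*} [CommRing A] [AddCommGroup M] [Module A M]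
    {p : Ideal A} (hM : (p • ⊤ : Submodule A M) ≠ ⊤)
    (hb : BddAbove {l : ℕ | ∃ rs : List A, rs.length = l ∧ (∀ r ∈ rs, r ∈ p) ∧
      IsRegular M rs}) :
    1 ≤ seqDepth p M ↔ ∃ a ∈ p, IsSMulRegular M a := by
  constructor
  · intro h
    obtain ⟨rs, hl, hrs, hreg⟩ := Nat.sSup_mem (Set.nonempty_iff_ne_empty.2 fun he => by
      simp [seqDepth, he] at h) hb
    cases rs with
    | nil =>
      rw [List.length_nil] at hl
      rw [seqDepth, ← hl] at h
      omega
    | cons r rs =>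
      exact ⟨r, hrs r (by simp), ((isRegular_cons_iff _ _ _).1 hreg).1⟩
  · rintro ⟨a, ha, hreg⟩
    refine le_csSup hb ⟨[a], rfl, by simpa using ha, (isWeaklyRegular_singleton_iff _ _).2 hreg,
      fun h => hM (top_le_iff.1 (h.le.trans (Submodule.smul_mono_left ?_)))⟩
    simpa [Ideal.span_le] using ha

end Depth

section Graded

variable {k R : Type*} [Field k] [CommRing R] [Algebra k R] (𝒜 : ℕ → Submodule k R)
  [GradedAlgebra 𝒜]

open DirectSum

theorem exists_algHom_ker_eq_irrelevant [Nontrivial R] (h0 : 𝒜 0 = 1) :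
    ∃ ε : R →ₐ[k] k, RingHom.ker ε = (HomogeneousIdeal.irrelevant 𝒜).toIdeal := by
  set m := (HomogeneousIdeal.irrelevant 𝒜).toIdeal with hm
  have hne : m ≠ ⊤ := by
    rw [hm, HomogeneousIdeal.toIdeal_irrelevant]
    exact RingHom.ker_ne_top _
  have : Nontrivial (R ⧸ m) := Ideal.Quotient.nontrivial_iff.2 hne
  have hbij : Function.Bijective (Algebra.ofId k (R ⧸ m)) := by
    refine ⟨(algebraMap k (R ⧸ m)).injective, fun x => ?_⟩
    obtain ⟨x, rfl⟩ := Ideal.Quotient.mk_surjective x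
    have hx : (decompose 𝒜 x 0 : R) ∈ (1 : Submodule k R) := h0 ▸ SetLike.coe_mem _
    obtain ⟨c, hc⟩ := Submodule.mem_one.1 hx
    refine ⟨c, ?_⟩
    change Ideal.Quotient.mk m (algebraMap k R c) = _
    rw [hc, Ideal.Quotient.eq]
    change GradedRing.proj 𝒜 0 _ = 0
    simp [GradedRing.proj_apply]
  refine ⟨(AlgEquiv.ofBijective _ hbij).symm.toAlgHom.comp (Ideal.Quotient.mkₐ k m), ?_⟩
  ext x
  simp [RingHom.mem_ker, Ideal.Quotient.eq_zero_iff_mem]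

theorem finiteType_of_generated_in_degree_one (h0 : 𝒜 0 = 1)
    (h1 : ∀ i : ℕ, 𝒜 (i + 1) = 𝒜 1 * 𝒜 i) (hfg : Module.Finite k (𝒜 1)) :
    Algebra.FiniteType k R := by
  obtain ⟨s, hs⟩ := Module.Finite.iff_fg.1 hfg
  refine ⟨⟨s, top_le_iff.1 fun x _ => ?_⟩⟩
  have h1s : 𝒜 1 ≤ Subalgebra.toSubmodule (Algebra.adjoin k (s : Set R)) :=
    hs ▸ Submodule.span_le.2 Algebra.subset_adjoin
  have h : ∀ i, 𝒜 i ≤ Subalgebra.toSubmodule (Algebra.adjoin k (s : Set R)) := by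
    intro i
    induction i with
    | zero => rw [h0, Submodule.one_le]; exact one_mem (Algebra.adjoin k (s : Set R))
    | succ i ih =>
      rw [h1, Submodule.mul_le]
      exact fun a ha b hb => (Algebra.adjoin k (s : Set R)).mul_mem (h1s ha) (ih hb)
  classical
  rw [← sum_support_decompose 𝒜 x]
  exact sum_mem fun i _ => h i (SetLike.coe_mem _)

theorem proj_one_eq_zero_of_mem_irrelevant_sq {x : R}
    (hx : x ∈ (HomogeneousIdeal.irrelevant 𝒜).toIdeal ^ 2) : GradedRing.proj 𝒜 1 x = 0 := by
  have hcl : ∀ y ∈ (HomogeneousIdeal.irrelevant 𝒜).toIdeal,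
      y ∈ AddSubmonoid.closure (⋃ i > 0, (𝒜 i : Set R)) := fun y hy => by
    rw [← HomogeneousIdeal.irrelevant_eq_closure]; exact hy
  rw [pow_two] at hx
  induction hx using Submodule.mul_induction_on' with
  | mem_mul_mem a ha b hb =>
    have ha' := hcl a ha
    have hb' := hcl b hb
    clear ha hb
    induction ha' using AddSubmonoid.closure_induction with
    | zero => simp
    | add a a' _ _ h h' => rw [add_mul, map_add, h, h', add_zero]
    | mem a ha =>
      induction hb' using AddSubmonoid.closure_induction with
      | zero => simp
      | add b b' _ _ h h' => rw [mul_add, map_add, h, h', add_zero]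
      | mem b hb =>
        obtain ⟨i, hi, ha⟩ := Set.mem_iUnion₂.1 ha
        obtain ⟨j, hj, hb⟩ := Set.mem_iUnion₂.1 hb
        exact decompose_of_mem_ne 𝒜 (SetLike.mul_mem_graded ha hb) (by omega)
  | add x _ y _ h h' => rw [map_add, h, h', add_zero]

theorem irrelevant_eq_bot_of_le_sq (h1 : ∀ i : ℕ, 𝒜 (i + 1) = 𝒜 1 * 𝒜 i)
    (h : (HomogeneousIdeal.irrelevant 𝒜).toIdeal ≤
      (HomogeneousIdeal.irrelevant 𝒜).toIdeal ^ 2) :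
    (HomogeneousIdeal.irrelevant 𝒜).toIdeal = ⊥ := by
  have hA1 : 𝒜 1 = ⊥ := (Submodule.eq_bot_iff _).2 fun x hx => by
    have := proj_one_eq_zero_of_mem_irrelevant_sq 𝒜
      (h (HomogeneousIdeal.mem_irrelevant_of_mem 𝒜 one_pos hx))
    rwa [GradedRing.proj_apply, decompose_of_mem_same 𝒜 hx] at this
  rw [HomogeneousIdeal.irrelevant_eq_span, Ideal.span_eq_bot]
  intro x hx
  simp only [Set.mem_iUnion] at hx
  obtain ⟨i, hi, hx⟩ := hx
  obtain ⟨i, rfl⟩ := Nat.exists_eq_add_of_lt hi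
  rw [zero_add, h1, hA1, Submodule.bot_mul] at hx
  exact hx

end Graded

/-- An element acting injectively on `ker ε ⧸ I` acts injectively on `R ⧸ I`. -/
theorem isSMulRegular_quotient_of_ker {k R : Type*} [Field k] [CommRing R] [Algebra k R]
    (ε : R →ₐ[k] k) {I : Ideal R} (hI : I ≤ RingHom.ker ε ^ 2)
    (hne : ¬ RingHom.ker ε ≤ RingHom.ker ε ^ 2) {a : R}
    (h : ∀ x ∈ RingHom.ker ε, a * x ∈ I → x ∈ I) : IsSMulRegular (R ⧸ I) a := by
  refine (isSMulRegular_quotient_iff_mem_of_smul_mem I a).2 fun x hx => ?_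
  rw [smul_eq_mul] at hx
  by_cases hxm : x ∈ RingHom.ker ε
  · exact h x hxm hx
  refine absurd (fun y hy => ?_) hne
  have hxy : x * y ∈ I := h _ (Ideal.mul_mem_left _ _ hy) (by
    rw [← mul_assoc]; exact I.mul_mem_right _ hx)
  have hx0 : ε x ≠ 0 := hxm
  set c : R := algebraMap k R (ε x)⁻¹
  have hz : 1 - c * x ∈ RingHom.ker ε := by
    simp [c, RingHom.mem_ker, hx0]
  have : y = (1 - c * x) * y + c * (x * y) := by ring
  rw [this]
  exact add_mem (pow_two (RingHom.ker ε) ▸ Ideal.mul_mem_mul hz hy)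
    (Ideal.mul_mem_left _ _ (hI hxy))

section FiberProduct

variable {k R S : Type*} [Field k] [CommRing R] [Algebra k R] [CommRing S] [Algebra k S]

/-- The projection `R ⊗[k] S → R` induced by an augmentation of `S`. -/
def tensorFst (R : Type*) [CommRing R] [Algebra k R] (εS : S →ₐ[k] k) : R ⊗[k] S →ₐ[k] R :=
  Algebra.TensorProduct.lift (AlgHom.id k R) ((Algebra.ofId k R).comp εS) fun _ _ => .all _ _

/-- The projection `R ⊗[k] S → S` induced by an augmentation of `R`. -/
def tensorSnd (S : Type*) [CommRing S] [Algebra k S] (εR : R →ₐ[k] k) : R ⊗[k] S →ₐ[k] S :=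
  Algebra.TensorProduct.lift ((Algebra.ofId k S).comp εR) (AlgHom.id k S) fun _ _ => .all _ _

@[simp]
theorem tensorFst_tmul (εS : S →ₐ[k] k) (r : R) (s : S) :
    tensorFst R εS (r ⊗ₜ s) = r * algebraMap k R (εS s) := rfl

@[simp]
theorem tensorSnd_tmul (εR : R →ₐ[k] k) (r : R) (s : S) :
    tensorSnd S εR (r ⊗ₜ s) = algebraMap k S (εR r) * s := rfl

variable (εR : R →ₐ[k] k) (εS : S →ₐ[k] k)

theorem augmentation_tensorFst (t : R ⊗[k] S) :
    εR (tensorFst R εS t) = εS (tensorSnd S εR t) := by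
  induction t with
  | zero => simp
  | add x y hx hy => simp [hx, hy]
  | tmul r s => simp

local notation "inl" => (Algebra.TensorProduct.includeLeft : R →ₐ[k] R ⊗[k] S)
local notation "inr" => (Algebra.TensorProduct.includeRight : S →ₐ[k] R ⊗[k] S)

/-- Modulo the product of the augmentation ideals, every tensor is the sum of its projections,
corrected by its augmentation. -/
theorem sub_tensorFst_add_tensorSnd_mem (t : R ⊗[k] S) :
    t - (inl (tensorFst R εS t) + inr (tensorSnd S εR t) -
      algebraMap k _ (εR (tensorFst R εS t))) ∈
      (RingHom.ker εR).map inl * (RingHom.ker εS).map inr := by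
  induction t with
  | zero => simp
  | add x y hx hy =>
    convert add_mem hx hy using 1
    simp only [map_add]
    ring
  | tmul r s =>
    have hr : r - algebraMap k R (εR r) ∈ RingHom.ker εR := by simp [RingHom.mem_ker]
    have hs : s - algebraMap k S (εS s) ∈ RingHom.ker εS := by simp [RingHom.mem_ker]
    convert Ideal.mul_mem_mul (Ideal.mem_map_of_mem inl hr) (Ideal.mem_map_of_mem inr hs) using 1
    have hrs : r ⊗ₜ[k] s = inl r * inr s := by simp
    rw [tensorFst_tmul, tensorSnd_tmul, hrs]
    simp only [map_sub, map_mul, AlgHom.commutes, Algebra.algebraMap_self, RingHom.id_apply]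
    ring

variable {εR εS} {I : Ideal R} {J : Ideal S}

theorem mem_fiberProduct_iff (hI : I ≤ RingHom.ker εR) (hJ : J ≤ RingHom.ker εS)
    {t : R ⊗[k] S} :
    t ∈ I.map inl + J.map inr + (RingHom.ker εR).map inl * (RingHom.ker εS).map inr ↔
      tensorFst R εS t ∈ I ∧ tensorSnd S εR t ∈ J := by
  constructor
  · suffices h : I.map inl + J.map inr + (RingHom.ker εR).map inl * (RingHom.ker εS).map inr ≤
        I.comap (tensorFst R εS) ⊓ J.comap (tensorSnd S εR) from fun ht => h ht
    refine sup_le (sup_le ?_ ?_) (Ideal.mul_le.2 fun a ha b hb => ?_)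
    · refine Ideal.map_le_iff_le_comap.2 fun x hx => ?_
      have : εR x = 0 := hI hx
      simp [this, hx]
    · refine Ideal.map_le_iff_le_comap.2 fun x hx => ?_
      have : εS x = 0 := hJ hx
      simp [this, hx]
    · have ha' : (RingHom.ker εR).map inl ≤ RingHom.ker (tensorSnd S εR) :=
        Ideal.map_le_iff_le_comap.2 fun x (hx : εR x = 0) => by simp [RingHom.mem_ker, hx]
      have hb' : (RingHom.ker εS).map inr ≤ RingHom.ker (tensorFst R εS) :=
        Ideal.map_le_iff_le_comap.2 fun x (hx : εS x = 0) => by simp [RingHom.mem_ker, hx]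
      have ha0 : tensorSnd S εR a = 0 := ha' ha
      have hb0 : tensorFst R εS b = 0 := hb' hb
      simp [ha0, hb0]
  · rintro ⟨h1, h2⟩
    have h0 : εR (tensorFst R εS t) = 0 := hI h1
    have h := sub_tensorFst_add_tensorSnd_mem εR εS t
    rw [h0, map_zero, sub_zero] at h
    rw [← add_sub_cancel (inl (tensorFst R εS t) + inr (tensorSnd S εR t)) t]
    exact Submodule.add_mem_sup (Submodule.add_mem_sup (Ideal.mem_map_of_mem _ h1)
      (Ideal.mem_map_of_mem _ h2)) h

theorem augmentation_tensorFst_eq_zero {t : R ⊗[k] S}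
    (ht : t ∈ (RingHom.ker εR).map inl + (RingHom.ker εS).map inr) :
    εR (tensorFst R εS t) = 0 := by
  suffices h : (RingHom.ker εR).map inl + (RingHom.ker εS).map inr ≤
      (RingHom.ker εR).comap (tensorFst R εS) from h ht
  refine sup_le ?_ ?_ <;>
    exact Ideal.map_le_iff_le_comap.2 fun x (hx : _ = _) => by
      simpa [RingHom.mem_ker] using hx

theorem isSMulRegular_fiberProduct_iff (hI : I ≤ RingHom.ker εR ^ 2)
    (hJ : J ≤ RingHom.ker εS ^ 2) (hR : ¬ RingHom.ker εR ≤ RingHom.ker εR ^ 2)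
    (hS : ¬ RingHom.ker εS ≤ RingHom.ker εS ^ 2) {F : Ideal (R ⊗[k] S)}
    (hF : ∀ t, t ∈ F ↔ tensorFst R εS t ∈ I ∧ tensorSnd S εR t ∈ J) {t : R ⊗[k] S} :
    IsSMulRegular (R ⊗[k] S ⧸ F) t ↔
      IsSMulRegular (R ⧸ I) (tensorFst R εS t) ∧ IsSMulRegular (S ⧸ J) (tensorSnd S εR t) := by
  have hI' := hI.trans (Ideal.pow_le_self two_ne_zero)
  have hJ' := hJ.trans (Ideal.pow_le_self two_ne_zero)
  constructor
  · intro h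
    have h := (isSMulRegular_quotient_iff_mem_of_smul_mem _ _).1 h
    simp only [hF, smul_eq_mul, map_mul] at h
    refine ⟨isSMulRegular_quotient_of_ker εR hI hR fun x hx hax => ?_,
      isSMulRegular_quotient_of_ker εS hJ hS fun x hx hax => ?_⟩
    · have hx : εR x = 0 := hx
      simpa [hx, hax] using h (inl x)
    · have hx : εS x = 0 := hx
      simpa [hx, hax] using h (inr x)
  · rintro ⟨h1, h2⟩
    refine (isSMulRegular_quotient_iff_mem_of_smul_mem _ _).2 fun x hx => ?_
    rw [smul_eq_mul, hF, map_mul, map_mul] at hx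
    exact (hF x).2 ⟨mem_of_isSMulRegular_quotient_of_smul_mem h1 hx.1,
      mem_of_isSMulRegular_quotient_of_smul_mem h2 hx.2⟩

open scoped Pointwise in
theorem length_le_one_of_isRegular_fiberProduct (hI : I ≤ RingHom.ker εR ^ 2)
    (hJ : J ≤ RingHom.ker εS ^ 2) (hR : ¬ RingHom.ker εR ≤ RingHom.ker εR ^ 2)
    (hS : ¬ RingHom.ker εS ≤ RingHom.ker εS ^ 2) {F : Ideal (R ⊗[k] S)}
    (hF : ∀ t, t ∈ F ↔ tensorFst R εS t ∈ I ∧ tensorSnd S εR t ∈ J) {rs : List (R ⊗[k] S)}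
    (hrs : ∀ r ∈ rs, εR (tensorFst R εS r) = 0)
    (h : IsRegular (R ⊗[k] S ⧸ F) rs) : rs.length ≤ 1 := by
  have hI' := hI.trans (Ideal.pow_le_self two_ne_zero)
  have hJ' := hJ.trans (Ideal.pow_le_self two_ne_zero)
  match rs, hrs, h with
  | [], _, _ => simp
  | [_], _, _ => simp
  | t :: u :: rs, hrs, h =>
    exfalso
    rw [isRegular_cons_iff, isRegular_cons_iff, isSMulRegular_fiberProduct_iff hI hJ hR hS hF] at h
    obtain ⟨⟨h1, h2⟩, hu, -⟩ := h
    have ht0 : εR (tensorFst R εS t) = 0 := hrs t (by simp)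
    have hu0 : εR (tensorFst R εS u) = 0 := hrs u (by simp)
    -- `inl (tensorFst t)` is killed by `u` modulo `t`, but is not a multiple of `t`
    have hz : (Submodule.Quotient.mk (inl (tensorFst R εS t)) : R ⊗[k] S ⧸ F) ∈
        t • (⊤ : Submodule (R ⊗[k] S) (R ⊗[k] S ⧸ F)) := by
      refine mem_of_isSMulRegular_quotient_of_smul_mem hu ?_
      rw [Submodule.mem_smul_pointwise_iff_exists]
      refine ⟨Submodule.Quotient.mk (inl (tensorFst R εS u)), trivial, ?_⟩
      rw [← Submodule.Quotient.mk_smul, ← Submodule.Quotient.mk_smul, Submodule.Quotient.eq, hF]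
      simp [ht0, hu0, mul_comm]
    rw [Submodule.mem_smul_pointwise_iff_exists] at hz
    obtain ⟨c, -, hc⟩ := hz
    obtain ⟨c, rfl⟩ := Submodule.Quotient.mk_surjective _ c
    rw [← Submodule.Quotient.mk_smul, Submodule.Quotient.eq, hF] at hc
    have hc1 : tensorFst R εS c - 1 ∈ I := mem_of_isSMulRegular_quotient_of_smul_mem h1 <| by
      simpa [mul_sub] using hc.1
    have hc2 : tensorSnd S εR c ∈ J := mem_of_isSMulRegular_quotient_of_smul_mem h2 <| by
      simpa [ht0] using hc.2
    have e1 : εR (tensorFst R εS c - 1) = 0 := hI' hc1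
    have e2 : εS (tensorSnd S εR c) = 0 := hJ' hc2
    rw [map_sub, augmentation_tensorFst, e2, map_one] at e1
    simp at e1

theorem seqDepth_fiberProduct [IsNoetherianRing R] [IsNoetherianRing S]
    (hI : I ≤ RingHom.ker εR ^ 2)
    (hJ : J ≤ RingHom.ker εS ^ 2) (hR : ¬ RingHom.ker εR ≤ RingHom.ker εR ^ 2)
    (hS : ¬ RingHom.ker εS ≤ RingHom.ker εS ^ 2)
    {F P : Ideal (R ⊗[k] S)}
    (hF : F = I.map inl + J.map inr + (RingHom.ker εR).map inl * (RingHom.ker εS).map inr)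
    (hP : P = (RingHom.ker εR).map inl + (RingHom.ker εS).map inr) :
    seqDepth P (R ⊗[k] S ⧸ F) =
      min 1 (min (seqDepth (RingHom.ker εR) (R ⧸ I)) (seqDepth (RingHom.ker εS) (S ⧸ J))) := by
  have hI' := hI.trans (Ideal.pow_le_self two_ne_zero)
  have hJ' := hJ.trans (Ideal.pow_le_self two_ne_zero)
  have hP0 : ∀ t ∈ P, εR (tensorFst R εS t) = 0 := by
    rw [hP]; exact fun t ht => augmentation_tensorFst_eq_zero ht
  have hFmem : ∀ t, t ∈ F ↔ tensorFst R εS t ∈ I ∧ tensorSnd S εR t ∈ J := fun t => by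
    rw [hF]; exact mem_fiberProduct_iff hI' hJ'
  have hub : 1 ∈ upperBounds {l : ℕ | ∃ rs : List (R ⊗[k] S), rs.length = l ∧
      (∀ r ∈ rs, r ∈ P) ∧
      IsRegular (R ⊗[k] S ⧸ F) rs} := by
    rintro _ ⟨rs, rfl, hrs, h⟩
    exact length_le_one_of_isRegular_fiberProduct hI hJ hR hS hFmem
      (fun r hr => hP0 r (hrs r hr)) h
  have hle : seqDepth P (R ⊗[k] S ⧸ F) ≤ 1 := csSup_le' hub
  have hFle : F ≤ P := by
    simp only [hF, hP, Submodule.add_eq_sup]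
    exact sup_le (sup_le_sup (Ideal.map_mono hI') (Ideal.map_mono hJ'))
      (Ideal.mul_le_right.trans le_sup_right)
  have hne : P ≠ ⊤ := fun h => by
    simpa using hP0 1 (by rw [h]; trivial)
  have hT := one_le_seqDepth_iff (smul_top_quotient_ne_top hFle hne) ⟨1, hub⟩
  have := RingHom.ker_isPrime εR
  have := RingHom.ker_isPrime εS
  have hA := one_le_seqDepth_iff (smul_top_quotient_ne_top hI' (RingHom.ker_ne_top εR))
    (bddAbove_length_isRegular_quotient hI')
  have hB := one_le_seqDepth_iff (smul_top_quotient_ne_top hJ' (RingHom.ker_ne_top εS))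
    (bddAbove_length_isRegular_quotient hJ')
  have key : 1 ≤ seqDepth P (R ⊗[k] S ⧸ F) ↔
      1 ≤ seqDepth (RingHom.ker εR) (R ⧸ I) ∧ 1 ≤ seqDepth (RingHom.ker εS) (S ⧸ J) := by
    rw [hT, hA, hB]
    simp only [isSMulRegular_fiberProduct_iff hI hJ hR hS hFmem]
    constructor
    · rintro ⟨t, ht, h1, h2⟩
      have h0 := hP0 t ht
      exact ⟨⟨_, h0, h1⟩, ⟨_, (augmentation_tensorFst εR εS t).symm.trans h0, h2⟩⟩
    · rintro ⟨⟨a, ha, h1⟩, ⟨b, hb, h2⟩⟩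
      refine ⟨inl a + inr b, ?_, ?_⟩
      · rw [hP]
        exact Submodule.add_mem_sup (Ideal.mem_map_of_mem _ ha) (Ideal.mem_map_of_mem _ hb)
      rw [RingHom.mem_ker] at ha hb
      simpa [ha, hb] using And.intro h1 h2
  generalize seqDepth P (R ⊗[k] S ⧸ F) = c at hle key ⊢
  generalize seqDepth (RingHom.ker εR) (R ⧸ I) = a at key ⊢
  generalize seqDepth (RingHom.ker εS) (S ⧸ J) = b at key ⊢
  omega

end FiberProduct

theorem depth_quotient_fiberProduct
    (k R S : Type*) [Field k] [CommRing R] [Algebra k R] [CommRing S] [Algebra k S]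
    (𝒜 : ℕ → Submodule k R) [GradedAlgebra 𝒜] (ℬ : ℕ → Submodule k S) [GradedAlgebra ℬ]
    -- `R` and `S` are standard graded
    (hA0 : 𝒜 0 = 1) (hA1 : ∀ i : ℕ, 𝒜 (i + 1) = 𝒜 1 * 𝒜 i) (hAfg : Module.Finite k (𝒜 1))
    (hB0 : ℬ 0 = 1) (hB1 : ∀ i : ℕ, ℬ (i + 1) = ℬ 1 * ℬ i) (hBfg : Module.Finite k (ℬ 1))
    -- the graded maximal ideals, assumed nonzero
    (m : Ideal R) (hm : m = (HomogeneousIdeal.irrelevant 𝒜).toIdeal) (hm0 : m ≠ ⊥)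
    (n : Ideal S) (hn : n = (HomogeneousIdeal.irrelevant ℬ).toIdeal) (hn0 : n ≠ ⊥)
    (I : Ideal R) (hIm : I ≤ m ^ 2) (hIhom : I.IsHomogeneous 𝒜)
    (J : Ideal S) (hJn : J ≤ n ^ 2) (hJhom : J.IsHomogeneous ℬ)
    -- the extensions of the various ideals to `T = R ⊗[k] S`
    (I' J' m' n' : Ideal (R ⊗[k] S))
    (hI' : I' = Ideal.map (Algebra.TensorProduct.includeLeft : R →ₐ[k] R ⊗[k] S) I)
    (hJ' : J' = Ideal.map (Algebra.TensorProduct.includeRight : S →ₐ[k] R ⊗[k] S) J)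
    (hm' : m' = Ideal.map (Algebra.TensorProduct.includeLeft : R →ₐ[k] R ⊗[k] S) m)
    (hn' : n' = Ideal.map (Algebra.TensorProduct.includeRight : S →ₐ[k] R ⊗[k] S) n)
    (F : Ideal (R ⊗[k] S)) (hF : F = I' + J' + m' * n') :
    seqDepth (m' + n') (R ⊗[k] S ⧸ F) =
      min 1 (min (seqDepth m (R ⧸ I)) (seqDepth n (S ⧸ J))) := by
  have hRnt : Nontrivial R := not_subsingleton_iff_nontrivial.1 fun _ =>
    hm0 (Subsingleton.elim _ _)
  have hSnt : Nontrivial S := not_subsingleton_iff_nontrivial.1 fun _ =>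
    hn0 (Subsingleton.elim _ _)
  obtain ⟨εR, hεR⟩ := exists_algHom_ker_eq_irrelevant 𝒜 hA0
  obtain ⟨εS, hεS⟩ := exists_algHom_ker_eq_irrelevant ℬ hB0
  have := finiteType_of_generated_in_degree_one 𝒜 hA0 hA1 hAfg
  have := finiteType_of_generated_in_degree_one ℬ hB0 hB1 hBfg
  have := Algebra.FiniteType.isNoetherianRing k R
  have := Algebra.FiniteType.isNoetherianRing k S
  have hR : ¬ m ≤ m ^ 2 := by
    subst hm
    exact fun h => hm0 (irrelevant_eq_bot_of_le_sq 𝒜 hA1 h)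
  have hS : ¬ n ≤ n ^ 2 := by
    subst hn
    exact fun h => hn0 (irrelevant_eq_bot_of_le_sq ℬ hB1 h)
  obtain rfl := hεR.trans hm.symm
  obtain rfl := hεS.trans hn.symm
  subst hI' hJ' hm' hn'
  exact seqDepth_fiberProduct hIm hJn hR hS hF rfl

end
end

section
/- Let k be a field, let R and S be polynomial rings over k in at least one variable each, with graded maximal ideals m and n, let I be a proper homogeneous ideal of R, and let T = R ⊗_k S. Then for every integer s ≥ 1 one has depth(T/(I + n)^{(s)}) = min_{1 ≤ i ≤ s} depth(R/I^{(i)}). -/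
/- STATEMENT 7: k a field, R and S polynomial rings over k in at least one variable each
with graded maximal ideals m and n, I a proper homogeneous ideal of R, T = R ⊗_k S.
Then for every s ≥ 1: depth(T/(I + n)^{(s)}) = min_{1 ≤ i ≤ s} depth(R/I^{(i)}). -/

open MvPolynomial

noncomputable section

/-- The graded maximal ideal of a polynomial ring, generated by the variables. -/
def mxI (k : Type*) [Field k] (σ : Type*) : Ideal (MvPolynomial σ k) :=
  Ideal.span (Set.range MvPolynomial.X)

/-- An ideal of a polynomial ring is homogeneous if it contains every homogeneous
component of each of its elements. -/
def IsHomogIdeal {k : Type*} [Field k] {σ : Type*} (I : Ideal (MvPolynomial σ k)) : Prop :=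
  ∀ f ∈ I, ∀ d : ℕ, MvPolynomial.homogeneousComponent d f ∈ I

/-- The `s`-th symbolic power of an ideal `a`: the intersection over all associated primes `P`
of `A ⧸ a` of the contraction of `a ^ s` extended to the localization at `P`. -/
def symbPow {A : Type*} [CommRing A] (a : Ideal A) (s : ℕ) : Ideal A :=
  sInf { J : Ideal A | ∃ (P : Ideal A) (hP : P ∈ associatedPrimes A (A ⧸ a)),
      haveI : P.IsPrime := IsAssociatedPrime.isPrime hP
      J = (Ideal.map (algebraMap A (Localization.AtPrime P)) (a ^ s)).comap
            (algebraMap A (Localization.AtPrime P)) }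

section RegularSequences

open RingTheory.Sequence
open scoped Pointwise

/-- Every element of `M` that `p` multiplies into `N` lies in `N`. -/
def NoSocle {A M : Type*} [CommRing A] [AddCommGroup M] [Module A M] (p : Ideal A)
    (N : Submodule A M) : Prop :=
  ∀ m : M, (∀ a ∈ p, a • m ∈ N) → m ∈ N

/-- `HasRegSeq p l N` says that there is a weakly regular sequence on `M ⧸ N` of length `l` with
entries in `p`. -/
def HasRegSeq {A M : Type*} [CommRing A] [AddCommGroup M] [Module A M] (p : Ideal A) :
    ℕ → Submodule A M → Prop
  | 0, _ => True
  | l + 1, N => ∃ x ∈ p, IsSMulRegular (M ⧸ N) x ∧ HasRegSeq p l (N ⊔ x • ⊤)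

section

variable {A M : Type*} [CommRing A] [AddCommGroup M] [Module A M] {p : Ideal A}
  {N : Submodule A M}

lemma mem_sup_smul_top_iff {x : A} {m : M} :
    m ∈ N ⊔ x • (⊤ : Submodule A M) ↔ ∃ w : M, m - x • w ∈ N := by
  rw [Submodule.mem_sup]
  constructor
  · rintro ⟨n, hn, _, hz, rfl⟩
    obtain ⟨w, -, rfl⟩ := (Submodule.mem_smul_pointwise_iff_exists _ _ _).1 hz
    exact ⟨w, by simpa using hn⟩
  · rintro ⟨w, hw⟩
    exact ⟨_, hw, x • w, Submodule.smul_mem_pointwise_smul _ _ _ trivial, by simp⟩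

lemma NoSocle.of_isSMulRegular {x : A} (hx : x ∈ p) (h : IsSMulRegular (M ⧸ N) x) :
    NoSocle p N := fun _ hm => mem_of_isSMulRegular_quotient_of_smul_mem h (hm x hx)

/-- Prime avoidance for regular elements on finitely many quotients. -/
lemma exists_isSMulRegular_of_noSocle [IsNoetherianRing A] [Module.Finite A M]
    {S : Set (Submodule A M)} (hS : S.Finite) (h : ∀ N ∈ S, NoSocle p N) :
    ∃ x ∈ p, ∀ N ∈ S, IsSMulRegular (M ⧸ N) x := by
  by_contra! hcon
  have hfin : (⋃ N ∈ S, associatedPrimes A (M ⧸ N)).Finite :=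
    hS.biUnion fun N _ => associatedPrimes.finite A (M ⧸ N)
  have hsub : (p : Set A) ⊆ ⋃ P ∈ (⋃ N ∈ S, associatedPrimes A (M ⧸ N)), (P : Set A) := by
    intro x hx
    obtain ⟨N, hN, hxN⟩ := hcon x hx
    have : x ∈ ⋃ P ∈ associatedPrimes A (M ⧸ N), (P : Set A) := by
      rw [biUnion_associatedPrimes_eq_compl_regular]
      exact hxN
    simp only [Set.mem_iUnion] at this ⊢
    obtain ⟨P, hP, hxP⟩ := this
    exact ⟨P, ⟨N, hN, hP⟩, hxP⟩
  have key := (p.subset_union_prime_finite hfin (f := id) 0 0 fun P hP _ _ => by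
    simp only [Set.mem_iUnion] at hP
    obtain ⟨N, hN, hP⟩ := hP
    exact hP.isPrime).1 hsub
  obtain ⟨P, hP, hpP⟩ := key
  simp only [Set.mem_iUnion] at hP
  obtain ⟨N, hN, hP⟩ := hP
  obtain ⟨hprime, x, hx⟩ := isAssociatedPrime_iff.1 hP
  obtain ⟨m, rfl⟩ := N.mkQ_surjective x
  have hm : m ∈ N := h N hN m fun a ha => by
    have : a ∈ P := hpP ha
    rw [hx, Submodule.mem_colon_singleton, ← map_smul] at this
    exact (Submodule.Quotient.mk_eq_zero N).1 this
  apply hprime.ne_top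
  rw [hx, (Submodule.mkQ_apply N m).trans ((Submodule.Quotient.mk_eq_zero N).2 hm)]
  simp

lemma NoSocle.exchange {x y : A} (hx : IsSMulRegular (M ⧸ N) x) (hy : IsSMulRegular (M ⧸ N) y)
    (hyp : y ∈ p) (h : NoSocle p (N ⊔ y • ⊤)) : NoSocle p (N ⊔ x • ⊤) := by
  intro m hm
  obtain ⟨w, hw⟩ := mem_sup_smul_top_iff.1 (hm y hyp)
  have hwN : w ∈ N ⊔ y • (⊤ : Submodule A M) := h w fun a ha => by
    obtain ⟨m₁, hm₁⟩ := mem_sup_smul_top_iff.1 (hm a ha)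
    refine mem_sup_smul_top_iff.2 ⟨m₁, mem_of_isSMulRegular_quotient_of_smul_mem hx ?_⟩
    have := N.sub_mem (N.smul_mem y hm₁) (N.smul_mem a hw)
    convert this using 1
    module
  obtain ⟨w', hw'⟩ := mem_sup_smul_top_iff.1 hwN
  refine mem_sup_smul_top_iff.2 ⟨w', mem_of_isSMulRegular_quotient_of_smul_mem hy ?_⟩
  have := N.add_mem hw (N.smul_mem x hw')
  convert this using 1
  module

lemma IsSMulRegular.exchange {x z : A} (hx : IsSMulRegular (M ⧸ N) x)
    (hz : IsSMulRegular (M ⧸ (N ⊔ x • (⊤ : Submodule A M))) z) :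
    IsSMulRegular (M ⧸ (N ⊔ z • (⊤ : Submodule A M))) x := by
  rw [isSMulRegular_quotient_iff_mem_of_smul_mem]
  intro m hm
  obtain ⟨m₁, hm₁⟩ := mem_sup_smul_top_iff.1 hm
  have : m₁ ∈ N ⊔ x • (⊤ : Submodule A M) := by
    refine mem_of_isSMulRegular_quotient_of_smul_mem hz (mem_sup_smul_top_iff.2 ⟨m, ?_⟩)
    rw [← neg_sub]
    exact N.neg_mem hm₁
  obtain ⟨m₂, hm₂⟩ := mem_sup_smul_top_iff.1 this
  refine mem_sup_smul_top_iff.2 ⟨m₂, mem_of_isSMulRegular_quotient_of_smul_mem hx ?_⟩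
  have := N.add_mem hm₁ (N.smul_mem z hm₂)
  convert this using 1
  module

lemma HasRegSeq.noSocle {l : ℕ} (h : HasRegSeq p (l + 1) N) : NoSocle p N := by
  obtain ⟨x, hx, hreg, -⟩ := h
  exact .of_isSMulRegular hx hreg

lemma HasRegSeq.of_succ {l : ℕ} (h : HasRegSeq p (l + 1) N) : HasRegSeq p l N := by
  induction l generalizing N with
  | zero => trivial
  | succ l ih =>
    obtain ⟨x, hx, hreg, h⟩ := h
    exact ⟨x, hx, hreg, ih h⟩

lemma HasRegSeq.mono {l l' : ℕ} (h : HasRegSeq p l N) (hl : l' ≤ l) : HasRegSeq p l' N := by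
  induction hl with
  | refl => exact h
  | step _ ih => exact ih h.of_succ

/-- Any regular element can be chosen as the first entry of a longest regular sequence. -/
lemma HasRegSeq.quot [IsNoetherianRing A] [Module.Finite A M] {l : ℕ}
    (h : HasRegSeq p (l + 1) N) {y : A} (hy : y ∈ p) (hreg : IsSMulRegular (M ⧸ N) y) :
    HasRegSeq p l (N ⊔ y • ⊤) := by
  induction l generalizing N y with
  | zero => trivial
  | succ l ih =>
    obtain ⟨x, hx, hxreg, h⟩ := h
    obtain ⟨z, hz, hzreg⟩ := exists_isSMulRegular_of_noSocle (p := p)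
      (S := {N, N ⊔ x • (⊤ : Submodule A M), N ⊔ y • (⊤ : Submodule A M)}) (by simp) (by
        rintro _ (rfl | rfl | rfl)
        · exact .of_isSMulRegular hy hreg
        · exact h.noSocle
        · exact .exchange hreg hxreg hx h.noSocle)
    have h₁ := ih h hz (hzreg _ (by simp))
    rw [sup_right_comm] at h₁
    have h₂ : HasRegSeq p (l + 1) (N ⊔ z • ⊤) := ⟨x, hx, hxreg.exchange (hzreg _ (by simp)), h₁⟩
    have h₃ := ih h₂ hy (hreg.exchange (hzreg _ (by simp)))
    rw [sup_right_comm] at h₃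
    exact ⟨z, hz, hzreg _ (by simp), h₃⟩

lemma exists_not_hasRegSeq [IsNoetherianRing A] [Module.Finite A M]
    (hN : N ⊔ p • ⊤ ≠ ⊤) : ∃ l, ¬ HasRegSeq p l N := by
  have : IsNoetherian A M := isNoetherian_of_isNoetherianRing_of_finite A M
  induction N using WellFoundedGT.induction with
  | ind N ih =>
    by_contra! hall
    obtain ⟨x, hx, hreg, -⟩ := hall 1
    have hxp : x • (⊤ : Submodule A M) ≤ p • ⊤ := by
      rw [← Submodule.ideal_span_singleton_smul]
      exact Submodule.smul_mono_left ((Ideal.span_singleton_le_iff_mem p).2 hx)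
    have hlt : N < N ⊔ x • ⊤ := by
      refine lt_of_le_of_ne le_sup_left fun heq => hN ?_
      rw [eq_top_iff]
      intro m _
      refine Submodule.mem_sup_left (mem_of_isSMulRegular_quotient_of_smul_mem hreg ?_)
      rw [heq]
      exact Submodule.mem_sup_right (Submodule.smul_mem_pointwise_smul _ _ _ trivial)
    obtain ⟨l, hl⟩ := ih _ hlt (by rwa [sup_assoc, sup_eq_right.2 hxp])
    exact hl ((hall (l + 1)).quot hx hreg)

lemma hasRegSeq_iff_exists_isWeaklyRegular {l : ℕ} :
    HasRegSeq p l N ↔ ∃ rs : List A, rs.length = l ∧ (∀ r ∈ rs, r ∈ p) ∧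
      IsWeaklyRegular (M ⧸ N) rs := by
  have key (N : Submodule A M) (x : A) (rs : List A) :
      IsWeaklyRegular (QuotSMulTop x (M ⧸ N)) rs ↔
        IsWeaklyRegular (M ⧸ (N ⊔ x • (⊤ : Submodule A M))) rs := by
    refine LinearEquiv.isWeaklyRegular_congr ?_ rs
    refine (Submodule.quotEquivOfEq _ _ ?_).trans
      (Submodule.quotientQuotientEquivQuotientSup N (x • ⊤))
    rw [Submodule.map_pointwise_smul, Submodule.map_top, Submodule.range_mkQ]
  induction l generalizing N with
  | zero =>
    refine iff_of_true trivial ⟨[], rfl, by simp, .nil _ _⟩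
  | succ l ih =>
    constructor
    · rintro ⟨x, hx, hreg, h⟩
      obtain ⟨rs, hl, hmem, hrs⟩ := ih.1 h
      exact ⟨x :: rs, by simp [hl], by simpa [hx] using hmem,
        (isWeaklyRegular_cons_iff _ _ _).2 ⟨hreg, (key _ _ _).2 hrs⟩⟩
    · rintro ⟨_ | ⟨x, rs⟩, hl, hmem, hrs⟩
      · simp at hl
      · obtain ⟨hreg, hrs⟩ := (isWeaklyRegular_cons_iff _ _ _).1 hrs
        exact ⟨x, hmem x (by simp), hreg, ih.2 ⟨rs, by simpa using hl,
          fun r hr => hmem r (by simp [hr]), (key _ _ _).1 hrs⟩⟩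

end

lemma HasRegSeq.congr {A M M' : Type*} [CommRing A] [AddCommGroup M] [Module A M]
    [AddCommGroup M'] [Module A M'] {p : Ideal A} {N : Submodule A M} {N' : Submodule A M'}
    (e : (M ⧸ N) ≃ₗ[A] (M' ⧸ N')) {l : ℕ} : HasRegSeq p l N ↔ HasRegSeq p l N' := by
  simp only [hasRegSeq_iff_exists_isWeaklyRegular, e.isWeaklyRegular_congr]

lemma isSMulRegular_quotient_pi_iff {A ι : Type*} [CommRing A] {M : ι → Type*}
    [∀ i, AddCommGroup (M i)] [∀ i, Module A (M i)] {N : ∀ i, Submodule A (M i)} {x : A} :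
    IsSMulRegular ((∀ i, M i) ⧸ Submodule.pi Set.univ N) x ↔
      ∀ i, IsSMulRegular (M i ⧸ N i) x := by
  classical
  simp only [isSMulRegular_quotient_iff_mem_of_smul_mem, Submodule.mem_pi, Set.mem_univ,
    true_implies]
  constructor
  · intro h i m hm
    have := h (Pi.single i m) (fun j => by
      obtain rfl | hj := eq_or_ne j i
      · simpa using hm
      · simp [hj]) i
    simpa using this
  · exact fun h m hm i => h i _ (hm i)

lemma pi_sup_smul_top {A ι : Type*} [CommRing A] {M : ι → Type*}
    [∀ i, AddCommGroup (M i)] [∀ i, Module A (M i)] {N : ∀ i, Submodule A (M i)} {x : A} :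
    Submodule.pi Set.univ N ⊔ x • ⊤ = Submodule.pi Set.univ fun i => N i ⊔ x • ⊤ := by
  ext m
  simp only [mem_sup_smul_top_iff, Submodule.mem_pi, Set.mem_univ, true_implies]
  exact ⟨fun ⟨w, hw⟩ i => ⟨w i, hw i⟩, fun h => ⟨fun i => (h i).choose, fun i => (h i).choose_spec⟩⟩

lemma hasRegSeq_pi_iff {A ι : Type*} [CommRing A] [IsNoetherianRing A] [Finite ι] {M : ι → Type*}
    [∀ i, AddCommGroup (M i)] [∀ i, Module A (M i)] [∀ i, Module.Finite A (M i)] {p : Ideal A}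
    {N : ∀ i, Submodule A (M i)} {l : ℕ} :
    HasRegSeq p l (Submodule.pi Set.univ N) ↔ ∀ i, HasRegSeq p l (N i) := by
  induction l generalizing N with
  | zero => exact iff_of_true trivial fun _ => trivial
  | succ l ih =>
    constructor
    · rintro ⟨x, hx, hreg, h⟩ i
      rw [pi_sup_smul_top, ih] at h
      exact ⟨x, hx, isSMulRegular_quotient_pi_iff.1 hreg i, h i⟩
    · intro h
      obtain ⟨x, hx, hreg⟩ := exists_isSMulRegular_of_noSocle (p := p)
        (S := {Submodule.pi Set.univ N}) (by simp) (by
          rintro _ rfl m hm i -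
          exact (h i).noSocle _ fun a ha => hm a ha i trivial)
      have hreg := hreg _ rfl
      refine ⟨x, hx, hreg, ?_⟩
      rw [pi_sup_smul_top, ih]
      exact fun i => (h i).quot hx (isSMulRegular_quotient_pi_iff.1 hreg i)

/-- Elements of `n` that are nilpotent on `M` modulo the extension of `p` do not matter for the
existence of regular sequences. -/
lemma hasRegSeq_restrictScalars_iff {R T M : Type*} [CommRing R] [CommRing T] [Algebra R T]
    [AddCommGroup M] [Module R M] [Module T M] [IsScalarTower R T M] [IsNoetherianRing R]
    [IsNoetherianRing T] [Module.Finite R M] {p : Ideal R} {n : Ideal T} {s : ℕ}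
    (hn : n ^ s ≤ Module.annihilator T M) {N : Submodule T M} {l : ℕ} :
    HasRegSeq (p.map (algebraMap R T) ⊔ n) l N ↔ HasRegSeq p l (N.restrictScalars R) := by
  have : Module.Finite T M := Module.Finite.of_restrictScalars_finite R T M
  have hreg (N : Submodule T M) (x : R) : IsSMulRegular (M ⧸ N) (algebraMap R T x) ↔
      IsSMulRegular (M ⧸ N.restrictScalars R) x := by
    simp [isSMulRegular_quotient_iff_mem_of_smul_mem]
  have hsup (N : Submodule T M) (x : R) :
      (N ⊔ algebraMap R T x • ⊤).restrictScalars R = N.restrictScalars R ⊔ x • ⊤ := by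
    ext m
    simp only [Submodule.restrictScalars_mem, mem_sup_smul_top_iff, algebraMap_smul]
  have hmem {x : R} (hx : x ∈ p) : algebraMap R T x ∈ p.map (algebraMap R T) ⊔ n :=
    Ideal.mem_sup_left (Ideal.mem_map_of_mem _ hx)
  induction l generalizing N with
  | zero => exact iff_of_true trivial trivial
  | succ l ih =>
    constructor
    · intro h
      obtain ⟨x, hx, hxreg⟩ := exists_isSMulRegular_of_noSocle (p := p)
        (S := {N.restrictScalars R}) (by simp) (by
          rintro _ rfl m hm
          by_contra hmN
          have hex : ∃ j, ∀ c ∈ n ^ j, c • m ∈ N := ⟨s, fun c hc => by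
            rw [Module.mem_annihilator.1 (hn hc) m]
            exact N.zero_mem⟩
          classical
          obtain ⟨j, hj⟩ : ∃ j, Nat.find hex = j := ⟨_, rfl⟩
          cases j with
          | zero =>
            have := (Nat.find_eq_zero hex).1 hj 1 (by simp)
            exact hmN (by simpa using this)
          | succ j =>
            have h₁ := Nat.find_spec hex
            rw [hj] at h₁
            have h₂ := Nat.find_min hex (m := j) (by omega)
            push Not at h₂
            obtain ⟨c, hc, hcm⟩ := h₂
            refine hcm (h.noSocle _ fun a ha => ?_)
            have hle : p.map (algebraMap R T) ⊔ n ≤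
                (N.colon {c • m} : Ideal T) := by
              refine sup_le (Ideal.map_le_iff_le_comap.2 fun a ha => ?_) fun a ha => ?_
              · rw [Ideal.mem_comap, Submodule.mem_colon_singleton, smul_comm]
                refine N.smul_mem c ?_
                simpa using hm a ha
              · rw [Submodule.mem_colon_singleton, smul_smul]
                exact h₁ _ (by rw [pow_succ']; exact Ideal.mul_mem_mul ha hc)
            exact Submodule.mem_colon_singleton.1 (hle ha))
      have hxreg := hxreg _ rfl
      refine ⟨x, hx, hxreg, ?_⟩
      rw [← hsup]
      exact ih.1 (h.quot (hmem hx) ((hreg _ _).2 hxreg))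
    · rintro ⟨x, hx, hxreg, h⟩
      refine ⟨_, hmem hx, (hreg _ _).2 hxreg, ih.2 ?_⟩
      rwa [hsup]

end RegularSequences

section SymbolicPowers

variable {A : Type*} [CommRing A]

/-- The contraction of the extension of `a ^ s` to the localization at `P`. -/
def localPow (a P : Ideal A) [P.IsPrime] (s : ℕ) : Ideal A :=
  (Ideal.map (algebraMap A (Localization.AtPrime P)) (a ^ s)).comap
    (algebraMap A (Localization.AtPrime P))

lemma mem_localPow {a P : Ideal A} [P.IsPrime] {s : ℕ} {f : A} :
    f ∈ localPow a P s ↔ ∃ u ∉ P, u * f ∈ a ^ s := by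
  rw [localPow, Ideal.mem_comap, IsLocalization.algebraMap_mem_map_algebraMap_iff P.primeCompl]
  rfl

lemma localPow_antitone (a P : Ideal A) [P.IsPrime] : Antitone (localPow a P) := fun _ _ hij =>
  Ideal.comap_mono (Ideal.map_mono (Ideal.pow_le_pow_right hij))

lemma mem_symbPow {a : Ideal A} {s : ℕ} {f : A} :
    f ∈ symbPow a s ↔ ∀ P ∈ associatedPrimes A (A ⧸ a), ∃ u ∉ P, u * f ∈ a ^ s := by
  simp only [symbPow, Submodule.mem_sInf, Set.mem_ofPred_eq]
  constructor
  · intro h P hP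
    have := IsAssociatedPrime.isPrime hP
    exact mem_localPow.1 (h _ ⟨P, hP, rfl⟩)
  · rintro h _ ⟨P, hP, rfl⟩
    have := IsAssociatedPrime.isPrime hP
    exact mem_localPow.2 (h P hP)

lemma one_notMem_of_mem_associatedPrimes {M : Type*} [AddCommGroup M] [Module A M] {P : Ideal A}
    (hP : P ∈ associatedPrimes A M) : (1 : A) ∉ P :=
  fun h => (IsAssociatedPrime.isPrime hP).ne_top ((Ideal.eq_top_iff_one _).2 h)

lemma pow_le_symbPow (a : Ideal A) (s : ℕ) : a ^ s ≤ symbPow a s := fun f hf =>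
  mem_symbPow.2 fun _ hP => ⟨1, one_notMem_of_mem_associatedPrimes hP, by simpa using hf⟩

lemma symbPow_zero (a : Ideal A) : symbPow a 0 = ⊤ :=
  top_le_iff.1 (by simpa using pow_le_symbPow a 0)

lemma symbPow_antitone (a : Ideal A) : Antitone (symbPow a) := fun i j hij f hf =>
  mem_symbPow.2 fun P hP => by
    obtain ⟨u, hu, h⟩ := mem_symbPow.1 hf P hP
    exact ⟨u, hu, Ideal.pow_le_pow_right hij h⟩

lemma symbPow_le [IsNoetherianRing A] (a : Ideal A) {s : ℕ} (hs : s ≠ 0) : symbPow a s ≤ a := by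
  intro f hf
  by_contra hfa
  obtain ⟨P, hP, hle⟩ := exists_le_isAssociatedPrime_of_isNoetherianRing A
    (Ideal.Quotient.mk a f) (by rwa [Ne, Ideal.Quotient.eq_zero_iff_mem])
  obtain ⟨u, hu, h⟩ := mem_symbPow.1 hf P hP
  refine hu (hle ?_)
  rw [Submodule.mem_colon_singleton, Submodule.mem_bot, Algebra.smul_def,
    Ideal.Quotient.algebraMap_eq, ← map_mul, Ideal.Quotient.eq_zero_iff_mem]
  exact Ideal.pow_le_self hs h

lemma mem_associatedPrimes_quotient_comap {B : Type*} [CommRing B] {f : A →+* B}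
    (hf : Function.Surjective f) {I : Ideal B} {P : Ideal A} :
    P ∈ associatedPrimes A (A ⧸ I.comap f) ↔
      ∃ Q ∈ associatedPrimes B (B ⧸ I), P = Q.comap f := by
  have hcolon (x : A) : (⊥ : Submodule A (A ⧸ I.comap f)).colon {Ideal.Quotient.mk _ x} =
      Ideal.comap f ((⊥ : Submodule B (B ⧸ I)).colon {Ideal.Quotient.mk _ (f x)}) := by
    ext a
    simp only [Ideal.mem_comap, Submodule.mem_colon_singleton, Submodule.mem_bot, Algebra.smul_def,
      Ideal.Quotient.algebraMap_eq, ← map_mul, Ideal.Quotient.eq_zero_iff_mem]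
  constructor
  · rintro ⟨hP, x, hx⟩
    obtain ⟨x, rfl⟩ := Ideal.Quotient.mk_surjective x
    rw [hcolon, ← Ideal.comap_radical] at hx
    refine ⟨_, ⟨?_, _, rfl⟩, hx⟩
    rw [hx] at hP
    rw [← Ideal.map_comap_of_surjective f hf
      (Ideal.radical ((⊥ : Submodule B (B ⧸ I)).colon {Ideal.Quotient.mk _ (f x)}))]
    exact Ideal.map_isPrime_of_surjective hf (Ideal.comap_mono bot_le)
  · rintro ⟨Q, ⟨hQ, x, hx⟩, rfl⟩
    obtain ⟨x, rfl⟩ := Ideal.Quotient.mk_surjective x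
    obtain ⟨x, rfl⟩ := hf x
    exact ⟨Ideal.comap_isPrime f Q, Ideal.Quotient.mk _ x, by rw [hcolon, hx, Ideal.comap_radical]⟩

lemma symbPow_comap_ringEquiv {B : Type*} [CommRing B] (e : A ≃+* B) (J : Ideal B) (s : ℕ) :
    symbPow (J.comap (e : A →+* B)) s = (symbPow J s).comap (e : A →+* B) := by
  have hpow : (J.comap (e : A →+* B)) ^ s = (J ^ s).comap (e : A →+* B) := by
    have h (K : Ideal B) : K.comap (e : A →+* B) = K.map (e.symm : B →+* A) :=
      (Ideal.map_symm (I := K) e).symm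
    rw [h, h, Ideal.map_pow]
  have hsurj : Function.Surjective (e : A →+* B) := e.surjective
  ext f
  rw [Ideal.mem_comap, mem_symbPow, mem_symbPow, hpow]
  constructor
  · intro h Q hQ
    obtain ⟨u, hu, h⟩ := h _ ((mem_associatedPrimes_quotient_comap hsurj).2 ⟨Q, hQ, rfl⟩)
    exact ⟨e u, hu, by simpa using h⟩
  · intro h P hP
    obtain ⟨Q, hQ, rfl⟩ := (mem_associatedPrimes_quotient_comap hsurj).1 hP
    obtain ⟨u, hu, h⟩ := h Q hQ
    obtain ⟨u, rfl⟩ := hsurj u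
    exact ⟨u, hu, by simpa using h⟩

end SymbolicPowers

section WeightedIdeal

variable {R : Type*} [CommRing R] {σ : Type*}

/-- For a decreasing sequence `Q` of ideals, the ideal `∑ᵢ Q i * n ^ (s - i)` of a polynomial ring,
where `n` is generated by the variables, described by coefficients. -/
def weightedIdeal (σ : Type*) (Q : ℕ → Ideal R) (hQ : Antitone Q) (s : ℕ) :
    Ideal (MvPolynomial σ R) where
  carrier := {f | ∀ β, coeff β f ∈ Q (s - β.degree)}
  add_mem' hf hg β := by
    rw [coeff_add]
    exact add_mem (hf β) (hg β)
  zero_mem' β := by simp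
  smul_mem' g f hf β := by
    classical
    rw [smul_eq_mul, coeff_mul]
    refine sum_mem fun c hc => Ideal.mul_mem_left _ _ (hQ ?_ (hf c.2))
    rw [Finset.HasAntidiagonal.mem_antidiagonal] at hc
    rw [← hc, map_add]
    omega

lemma mem_weightedIdeal {Q : ℕ → Ideal R} {hQ : Antitone Q} {s : ℕ} {f : MvPolynomial σ R} :
    f ∈ weightedIdeal σ Q hQ s ↔ ∀ β, coeff β f ∈ Q (s - β.degree) := Iff.rfl

lemma monomial_mem_idealOfVars_pow (β : σ →₀ ℕ) (c : R) :
    monomial β c ∈ idealOfVars σ R ^ β.degree := by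
  classical
  rw [mem_pow_idealOfVars_iff']
  intro x hx
  rw [coeff_monomial, if_neg]
  rintro rfl
  exact lt_irrefl _ hx

lemma pow_antitone (I : Ideal R) : Antitone fun i => I ^ i := fun _ _ h => Ideal.pow_le_pow_right h

lemma map_C_sup_idealOfVars_pow (I : Ideal R) (s : ℕ) :
    (I.map C ⊔ idealOfVars σ R) ^ s = weightedIdeal σ (fun i => I ^ i) (pow_antitone I) s := by
  classical
  apply le_antisymm
  · induction s with
    | zero => intro f _ β; simp
    | succ s ih =>
      have hle : I.map C ⊔ idealOfVars σ R ≤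
          weightedIdeal σ (fun i => I ^ i) (pow_antitone I) 1 := by
        refine sup_le (fun f hf β => ?_) (fun f hf β => ?_)
        · refine pow_antitone I (Nat.sub_le 1 _) ?_
          simpa using mem_map_C_iff.1 hf β
        · obtain hβ | hβ := Nat.eq_zero_or_pos β.degree
          · rw [← pow_one (idealOfVars σ R), mem_pow_idealOfVars_iff'] at hf
            rw [hf β (by omega)]
            exact zero_mem _
          · simp [Nat.sub_eq_zero_of_le hβ]
      rw [pow_succ, Ideal.mul_le]
      intro f hf g hg β
      rw [coeff_mul]
      refine sum_mem fun c hc => ?_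
      rw [Finset.HasAntidiagonal.mem_antidiagonal] at hc
      have := Ideal.mul_mem_mul (ih hf c.1) (hle hg c.2)
      rw [← pow_add] at this
      refine pow_antitone I ?_ this
      rw [← hc, map_add]
      omega
  · intro f hf
    rw [as_sum f]
    refine sum_mem fun β _ => ?_
    rw [← mul_one (coeff β f), ← C_mul_monomial]
    have h₁ : (C (coeff β f) : MvPolynomial σ R) ∈
        (I.map C ⊔ idealOfVars σ R) ^ (s - β.degree) := by
      refine Ideal.pow_right_mono (le_sup_left : I.map C ≤ _) _ ?_
      rw [← Ideal.map_pow]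
      exact Ideal.mem_map_of_mem _ (hf β)
    have h₂ : monomial β (1 : R) ∈ (I.map C ⊔ idealOfVars σ R) ^ β.degree :=
      Ideal.pow_right_mono le_sup_right _ (monomial_mem_idealOfVars_pow β 1)
    have := Ideal.mul_mem_mul h₁ h₂
    rw [← pow_add] at this
    exact Ideal.pow_le_pow_right (by omega) this

lemma map_C_sup_idealOfVars (I : Ideal R) :
    I.map C ⊔ idealOfVars σ R = I.comap (constantCoeff : MvPolynomial σ R →+* R) := by
  ext f
  rw [← pow_one (I.map C ⊔ idealOfVars σ R), map_C_sup_idealOfVars_pow, mem_weightedIdeal,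
    Ideal.mem_comap, constantCoeff_eq]
  constructor
  · intro h
    simpa using h 0
  · intro h β
    obtain rfl | hβ := eq_or_ne β 0
    · simpa using h
    · have : 1 ≤ β.degree := Nat.one_le_iff_ne_zero.2 (by rwa [Ne, Finsupp.degree_eq_zero_iff])
      simp [Nat.sub_eq_zero_of_le this]

/-- Binomial expansion of symbolic powers: `(I + n)^{(s)} = ∑ᵢ I^{(i)} n ^ (s - i)`. -/
lemma symbPow_map_C_sup_idealOfVars (I : Ideal R) (s : ℕ) :
    symbPow (I.map C ⊔ idealOfVars σ R) s =
      weightedIdeal σ (symbPow I) (symbPow_antitone I) s := by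
  classical
  have hsurj : Function.Surjective (constantCoeff : MvPolynomial σ R →+* R) :=
    fun r => ⟨C r, constantCoeff_C σ r⟩
  have hass (P : Ideal (MvPolynomial σ R)) :
      P ∈ associatedPrimes _ (MvPolynomial σ R ⧸ (I.map C ⊔ idealOfVars σ R)) ↔
        ∃ Q ∈ associatedPrimes R (R ⧸ I), P = Q.comap constantCoeff := by
    rw [map_C_sup_idealOfVars]
    exact mem_associatedPrimes_quotient_comap hsurj
  ext f
  rw [mem_symbPow, mem_weightedIdeal]
  constructor
  · intro h β
    rw [mem_symbPow]
    intro Q hQ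
    obtain ⟨u, hu, huf⟩ := h _ ((hass _).2 ⟨Q, hQ, rfl⟩)
    have hprime := IsAssociatedPrime.isPrime hQ
    rw [map_C_sup_idealOfVars_pow, mem_weightedIdeal] at huf
    rw [← mem_localPow]
    induction hd : β.degree using Nat.strong_induction_on generalizing β with
    | _ d ih =>
      subst hd
      have hsum : coeff β (u * f) ∈ localPow I Q (s - β.degree) :=
        mem_localPow.2 ⟨1, one_notMem_of_mem_associatedPrimes hQ, by simpa using huf β⟩
      have hmem : (0, β) ∈ Finset.HasAntidiagonal.antidiagonal β := by simp
      rw [coeff_mul, ← Finset.add_sum_erase _ _ hmem] at hsum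
      have hrest : ∑ c ∈ (Finset.HasAntidiagonal.antidiagonal β).erase (0, β),
          coeff c.1 u * coeff c.2 f ∈ localPow I Q (s - β.degree) := by
        refine sum_mem fun c hc => Ideal.mul_mem_left _ _ ?_
        rw [Finset.mem_erase, Finset.HasAntidiagonal.mem_antidiagonal] at hc
        obtain ⟨hne, hc⟩ := hc
        have hc1 : c.1 ≠ 0 := by
          intro h0
          refine hne (Prod.ext h0 ?_)
          simpa [h0] using hc
        have hpos : 0 < c.1.degree :=
          Nat.pos_of_ne_zero (by rwa [Ne, Finsupp.degree_eq_zero_iff])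
        have hdeg : c.1.degree + c.2.degree = β.degree := by rw [← hc, map_add]
        exact localPow_antitone I Q (by omega) (ih _ (by omega) c.2 rfl)
      have h0 := (Submodule.add_mem_iff_left _ hrest).1 hsum
      obtain ⟨v, hv, hv'⟩ := mem_localPow.1 h0
      refine mem_localPow.2 ⟨v * coeff 0 u, ?_, by rwa [mul_assoc]⟩
      rw [hprime.mul_mem_iff_mem_or_mem]
      rintro (h | h)
      · exact hv h
      · exact hu h
  · intro h P hP
    obtain ⟨Q, hQ, rfl⟩ := (hass P).1 hP
    have hPprime := IsAssociatedPrime.isPrime hP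
    rw [← mem_localPow, as_sum f]
    refine sum_mem fun β _ => mem_localPow.2 ?_
    obtain ⟨u, hu, huf⟩ := mem_symbPow.1 (h β) Q hQ
    refine ⟨C u, by simpa using hu, ?_⟩
    rw [map_C_sup_idealOfVars_pow, mem_weightedIdeal]
    intro γ
    rw [C_mul_monomial, coeff_monomial]
    split_ifs with hγ
    · rwa [← hγ]
    · exact zero_mem _

end WeightedIdeal

section Depth

open RingTheory.Sequence
open scoped Pointwise

lemma isRegular_quotient_iff {A : Type*} [CommRing A] {p N : Ideal A} (hp : p ≠ ⊤) (hN : N ≤ p)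
    {rs : List A} (hrs : ∀ r ∈ rs, r ∈ p) :
    IsRegular (A ⧸ N) rs ↔ IsWeaklyRegular (A ⧸ N) rs := by
  refine ⟨fun h => h.toIsWeaklyRegular, fun h => ⟨h, fun htop => hp ?_⟩⟩
  have hle : Ideal.ofList rs ≤ p := Ideal.span_le.2 hrs
  have h1 : (Submodule.mkQ N) 1 ∈ Ideal.ofList rs • (⊤ : Submodule A (A ⧸ N)) := by
    rw [← htop]
    trivial
  rw [← Submodule.mem_comap, Submodule.comap_smul_top_of_surjective _ _ N.mkQ_surjective,
    Submodule.ker_mkQ] at h1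
  rw [Ideal.eq_top_iff_one]
  refine sup_le ?_ hN h1
  simpa using hle

lemma hasRegSeq_iff_le_seqDepth {A : Type*} [CommRing A] [IsNoetherianRing A] {p N : Ideal A}
    (hp : p ≠ ⊤) (hN : N ≤ p) {l : ℕ} : HasRegSeq p l N ↔ l ≤ seqDepth p (A ⧸ N) := by
  have hset : {l : ℕ | ∃ rs : List A, rs.length = l ∧ (∀ r ∈ rs, r ∈ p) ∧
      IsRegular (A ⧸ N) rs} = {l | HasRegSeq p l N} := by
    ext l
    simp only [Set.mem_ofPred_eq, hasRegSeq_iff_exists_isWeaklyRegular]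
    refine exists_congr fun rs => and_congr_right fun _ => and_congr_right fun h => ?_
    exact isRegular_quotient_iff hp hN h
  obtain ⟨L, hL⟩ := exists_not_hasRegSeq (p := p) (N := N) (by simpa [sup_eq_right.2 hN] using hp)
  have hbdd : BddAbove {l | HasRegSeq p l N} :=
    ⟨L, fun l hl => le_of_not_ge fun h => hL (HasRegSeq.mono hl h)⟩
  rw [seqDepth, hset]
  exact ⟨fun h => le_csSup hbdd h,
    fun h => HasRegSeq.mono (Nat.sSup_mem ⟨0, show HasRegSeq p 0 N from trivial⟩ hbdd) h⟩

lemma seqDepth_comap_ringEquiv {A B : Type*} [CommRing A] [CommRing B] (e : A ≃+* B)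
    (q F : Ideal B) :
    seqDepth (q.comap (e : A →+* B)) (A ⧸ F.comap (e : A →+* B)) = seqDepth q (B ⧸ F) := by
  have hF : F = (F.comap (e : A →+* B)).map (e : A →+* B) :=
    (Ideal.map_comap_of_surjective (e : A →+* B) e.surjective F).symm
  let g : (A ⧸ F.comap (e : A →+* B)) ≃+* (B ⧸ F) := Ideal.quotientEquiv _ _ e hF
  have key (rs : List A) : IsRegular (A ⧸ F.comap (e : A →+* B)) rs ↔
      IsRegular (B ⧸ F) (rs.map e) := by
    refine AddEquiv.isRegular_congr (e := g.toAddEquiv) ?_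
    rw [List.forall₂_map_right_iff, List.forall₂_same]
    intro r _ x
    obtain ⟨x, rfl⟩ := Ideal.Quotient.mk_surjective x
    change g (Ideal.Quotient.mk _ (r * x)) = Ideal.Quotient.mk _ (e r) * g (Ideal.Quotient.mk _ x)
    simp [g]
  rw [seqDepth, seqDepth]
  congr 1
  ext l
  constructor
  · rintro ⟨rs, hl, hmem, h⟩
    exact ⟨rs.map e, by simpa using hl, by simpa using hmem, (key rs).1 h⟩
  · rintro ⟨rs, hl, hmem, h⟩
    refine ⟨rs.map e.symm, by simpa using hl, by simpa using hmem, (key _).2 ?_⟩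
    simpa [Function.comp_def] using h

/-- The quotient of a polynomial ring by a weighted ideal is a finite product of quotients of the
coefficient ring. -/
lemma nonempty_quotient_weightedIdeal_equiv {R : Type*} [CommRing R] {σ : Type*} [Finite σ]
    (Q : ℕ → Ideal R) (hQ : Antitone Q) (hQ₀ : Q 0 = ⊤) (s : ℕ) :
    Nonempty ((MvPolynomial σ R ⧸ weightedIdeal σ Q hQ s) ≃ₗ[R]
      ({β : σ →₀ ℕ // β.degree < s} → R) ⧸
        Submodule.pi Set.univ fun β : {β : σ →₀ ℕ // β.degree < s} => Q (s - β.1.degree)) := by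
  classical
  have : Finite {β : σ →₀ ℕ // β.degree < s} := Finsupp.finite_of_degree_lt s
  have := Fintype.ofFinite {β : σ →₀ ℕ // β.degree < s}
  set N := Submodule.pi Set.univ fun β : {β : σ →₀ ℕ // β.degree < s} => Q (s - β.1.degree)
  let φ : MvPolynomial σ R →ₗ[R] {β : σ →₀ ℕ // β.degree < s} → R :=
    LinearMap.pi fun β => lcoeff R β.1
  have hφ : Function.Surjective φ := fun r => by
    refine ⟨∑ β, monomial β.1 (r β), ?_⟩
    ext γ
    simp [φ, coeff_monomial, Subtype.val_inj]
  have hker : LinearMap.ker (N.mkQ ∘ₗ φ) = (weightedIdeal σ Q hQ s).restrictScalars R := by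
    ext f
    rw [LinearMap.ker_comp, Submodule.ker_mkQ, Submodule.mem_comap, Submodule.restrictScalars_mem,
      mem_weightedIdeal, Submodule.mem_pi]
    constructor
    · intro h β
      by_cases hβ : β.degree < s
      · exact h ⟨β, hβ⟩ trivial
      · rw [Nat.sub_eq_zero_of_le (not_lt.1 hβ), hQ₀]
        trivial
    · exact fun h β _ => h β.1
  exact ⟨(Submodule.Quotient.restrictScalarsEquiv R (weightedIdeal σ Q hQ s)).symm.trans
    ((Submodule.quotEquivOfEq _ _ hker.symm).trans
      (LinearMap.quotKerEquivOfSurjective (N.mkQ ∘ₗ φ) (N.mkQ_surjective.comp hφ)))⟩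

lemma hasRegSeq_weightedIdeal_iff {R : Type*} [CommRing R] [IsNoetherianRing R] {σ : Type*}
    [Finite σ] {p : Ideal R} {Q : ℕ → Ideal R} {hQ : Antitone Q} (hQ₀ : Q 0 = ⊤) {s l : ℕ} :
    HasRegSeq (p.map C ⊔ idealOfVars σ R) l (weightedIdeal σ Q hQ s) ↔
      ∀ β : {β : σ →₀ ℕ // β.degree < s}, HasRegSeq p l (Q (s - β.1.degree)) := by
  have : Finite {β : σ →₀ ℕ // β.degree < s} := Finsupp.finite_of_degree_lt s
  obtain ⟨e⟩ := nonempty_quotient_weightedIdeal_equiv (σ := σ) Q hQ hQ₀ s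
  set F := weightedIdeal σ Q hQ s
  have : Module.Finite R (MvPolynomial σ R ⧸ F) := Module.Finite.equiv e.symm
  have hann : idealOfVars σ R ^ s ≤ Module.annihilator (MvPolynomial σ R)
      (MvPolynomial σ R ⧸ F) := by
    rw [Ideal.annihilator_quotient]
    intro f hf β
    by_cases hβ : β.degree < s
    · rw [(mem_pow_idealOfVars_iff' s f).1 hf β hβ]
      exact zero_mem _
    · rw [Nat.sub_eq_zero_of_le (not_lt.1 hβ), hQ₀]
      trivial
  rw [← hasRegSeq_pi_iff (M := fun _ => R), ← HasRegSeq.congr (Submodule.quotEquivOfEqBot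
    (⊥ : Submodule (MvPolynomial σ R) (MvPolynomial σ R ⧸ F)) rfl)]
  have h₁ : HasRegSeq (p.map C ⊔ idealOfVars σ R) l
      (⊥ : Submodule (MvPolynomial σ R) (MvPolynomial σ R ⧸ F)) ↔ HasRegSeq p l
        ((⊥ : Submodule (MvPolynomial σ R) (MvPolynomial σ R ⧸ F)).restrictScalars R) :=
    hasRegSeq_restrictScalars_iff hann
  rw [h₁]
  exact HasRegSeq.congr ((Submodule.quotEquivOfEqBot _ (Submodule.restrictScalars_bot ..)).trans e)

/-- The depth of the quotient by a symbolic power of `I + n` is bounded below by `l` exactly when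
the depths of the quotients by the lower symbolic powers of `I` are. -/
lemma le_seqDepth_symbPow_sup_iff {R : Type*} [CommRing R] [IsNoetherianRing R] {σ : Type*}
    [Finite σ] [Nonempty σ] {p I : Ideal R} (hp : p ≠ ⊤) (hI : I ≤ p) {s l : ℕ} (hs : s ≠ 0) :
    l ≤ seqDepth (p.map C ⊔ idealOfVars σ R)
        (MvPolynomial σ R ⧸ symbPow (I.map C ⊔ idealOfVars σ R) s) ↔
      ∀ i ∈ Finset.Icc 1 s, l ≤ seqDepth p (R ⧸ symbPow I i) := by
  have hq : p.map C ⊔ idealOfVars σ R ≠ ⊤ := by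
    rw [map_C_sup_idealOfVars, Ne, Ideal.comap_eq_top_iff]
    exact hp
  rw [← hasRegSeq_iff_le_seqDepth hq ((symbPow_le _ hs).trans
    (sup_le_sup_right (Ideal.map_mono hI) _)), symbPow_map_C_sup_idealOfVars,
    hasRegSeq_weightedIdeal_iff (symbPow_zero I)]
  have hiff (i : ℕ) (hi : i ≠ 0) : HasRegSeq p l (symbPow I i) ↔
      l ≤ seqDepth p (R ⧸ symbPow I i) :=
    hasRegSeq_iff_le_seqDepth hp ((symbPow_le I hi).trans hI)
  constructor
  · intro h i hi
    obtain ⟨hi₁, his⟩ := Finset.mem_Icc.1 hi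
    have hdeg : (Finsupp.single (Classical.arbitrary σ) (s - i)).degree = s - i :=
      Finsupp.degree_single _ _
    have := h ⟨Finsupp.single (Classical.arbitrary σ) (s - i), by omega⟩
    simp only [hdeg, Nat.sub_sub_self his] at this
    exact (hiff i (by omega)).1 this
  · intro h β
    have := β.2
    exact (hiff _ (by omega)).2 (h _ (Finset.mem_Icc.2 (by omega)))

end Depth

lemma IsHomogIdeal.le_mxI {k σ : Type*} [Field k] {I : Ideal (MvPolynomial σ k)}
    (hI : IsHomogIdeal I) (hne : I ≠ ⊤) : I ≤ mxI k σ := by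
  intro f hf
  change f ∈ idealOfVars σ k
  rw [← pow_one (idealOfVars σ k), mem_pow_idealOfVars_iff']
  intro x hx
  obtain rfl : x = 0 := by rwa [Nat.lt_one_iff, Finsupp.degree_eq_zero_iff] at hx
  by_contra h
  have := hI f hf 0
  rw [homogeneousComponent_zero] at this
  exact hne (Ideal.eq_top_of_isUnit_mem I this ((isUnit_iff_ne_zero.2 h).map C))

lemma mxI_ne_top (k σ : Type*) [Field k] : mxI k σ ≠ ⊤ := by
  change idealOfVars σ k ≠ ⊤
  have := map_C_sup_idealOfVars (σ := σ) (⊥ : Ideal k)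
  rw [Ideal.map_bot, bot_sup_eq] at this
  rw [this, Ne, Ideal.comap_eq_top_iff]
  exact bot_ne_top

/-- The polynomial ring in `σ ⊕ τ` as an iterated polynomial ring, with coefficients in the
variables `σ`. -/
def sumEquiv (k σ τ : Type*) [Field k] :
    MvPolynomial (σ ⊕ τ) k ≃+* MvPolynomial τ (MvPolynomial σ k) :=
  ((renameEquiv k (Equiv.sumComm σ τ)).trans (sumAlgEquiv k τ σ)).toRingEquiv

lemma sumEquiv_rename_inl {k σ τ : Type*} [Field k] (f : MvPolynomial σ k) :
    sumEquiv k σ τ (rename Sum.inl f) = C f := by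
  induction f using MvPolynomial.induction_on with
  | C c => simp [sumEquiv]
  | add f g hf hg => simp [hf, hg]
  | mul_X f i hf =>
    rw [map_mul, map_mul, hf, map_mul]
    simp [sumEquiv]

lemma sumEquiv_X_inr {k σ τ : Type*} [Field k] (j : τ) :
    sumEquiv k σ τ (X (Sum.inr j)) = X j := by
  simp [sumEquiv]

lemma map_rename_add_map_rename_mxI {k σ τ : Type*} [Field k] (J : Ideal (MvPolynomial σ k)) :
    Ideal.map (rename (Sum.inl : σ → σ ⊕ τ) : MvPolynomial σ k →ₐ[k] MvPolynomial (σ ⊕ τ) k) J +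
        Ideal.map (rename (Sum.inr : τ → σ ⊕ τ) : MvPolynomial τ k →ₐ[k] MvPolynomial (σ ⊕ τ) k)
          (mxI k τ) =
      (J.map C ⊔ idealOfVars τ (MvPolynomial σ k)).comap (sumEquiv k σ τ : _ →+* _) := by
  have hbij : Function.Bijective
      (sumEquiv k σ τ : MvPolynomial (σ ⊕ τ) k →+* MvPolynomial τ (MvPolynomial σ k)) :=
    (sumEquiv k σ τ).bijective
  have hinj := Function.LeftInverse.injective fun K => Ideal.comap_map_of_bijective _ hbij (I := K)
  apply hinj
  rw [Ideal.map_comap_of_surjective _ hbij.surjective, Ideal.add_eq_sup, Ideal.map_sup]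
  congr 1
  · have h : RingHom.comp
        (sumEquiv k σ τ : MvPolynomial (σ ⊕ τ) k →+* MvPolynomial τ (MvPolynomial σ k))
        (rename Sum.inl : MvPolynomial σ k →ₐ[k] MvPolynomial (σ ⊕ τ) k) = C :=
      RingHom.ext sumEquiv_rename_inl
    rw [← h, ← Ideal.map_map]
    rfl
  · rw [mxI, Ideal.map_span, Ideal.map_span, ← Set.range_comp, ← Set.range_comp, idealOfVars]
    congr 2
    ext1 j
    simp [sumEquiv_X_inr]

theorem depth_symbPow_sum_with_maximal_ideal
    (k : Type*) [Field k] (a b : ℕ) (ha : 0 < a) (hb : 0 < b)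
    (I : Ideal (MvPolynomial (Fin a) k)) (hIproper : I ≠ ⊤) (hIhom : IsHomogIdeal I)
    -- the extensions of `I`, `m` and `n` to `T`, the polynomial ring in the disjoint
    -- union of the variables
    (I' m' n' : Ideal (MvPolynomial (Fin a ⊕ Fin b) k))
    (hI' : I' = Ideal.map (rename (Sum.inl : Fin a → Fin a ⊕ Fin b) :
      MvPolynomial (Fin a) k →ₐ[k] MvPolynomial (Fin a ⊕ Fin b) k) I)
    (hm' : m' = Ideal.map (rename (Sum.inl : Fin a → Fin a ⊕ Fin b) :
      MvPolynomial (Fin a) k →ₐ[k] MvPolynomial (Fin a ⊕ Fin b) k) (mxI k (Fin a)))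
    (hn' : n' = Ideal.map (rename (Sum.inr : Fin b → Fin a ⊕ Fin b) :
      MvPolynomial (Fin b) k →ₐ[k] MvPolynomial (Fin a ⊕ Fin b) k) (mxI k (Fin b)))
    (s : ℕ) (hs : 1 ≤ s) :
    seqDepth (m' + n')
        (MvPolynomial (Fin a ⊕ Fin b) k ⧸ symbPow (I' + n') s) =
      (Finset.Icc 1 s).inf' (Finset.nonempty_Icc.mpr hs)
        (fun i => seqDepth (mxI k (Fin a)) (MvPolynomial (Fin a) k ⧸ symbPow I i)) := by
  have : Nonempty (Fin b) := ⟨⟨0, hb⟩⟩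
  subst hI' hm' hn'
  refine eq_of_forall_le_iff fun l => ?_
  rw [map_rename_add_map_rename_mxI, map_rename_add_map_rename_mxI, symbPow_comap_ringEquiv,
    seqDepth_comap_ringEquiv, Finset.le_inf'_iff]
  exact le_seqDepth_symbPow_sup_iff (mxI_ne_top k _) (hIhom.le_mxI hIproper) (by omega)

end
end

section
/- Let k be a field, let R and S be polynomial rings over k in at least one variable each, with graded maximal ideals m and n, let I ⊆ m² and J ⊆ n² be proper homogeneous ideals, let T = R ⊗_k S, and let F = I + J + mn ⊆ T. Then Ass_T(T/F) = {p₁T + nT : p₁ ∈ Ass_R(R/I)} ∪ {p₂T + mT : p₂ ∈ Ass_S(S/J)}. -/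
/- STATEMENT 8: k a field, R and S polynomial rings over k in at least one variable each
with graded maximal ideals m and n, I ⊆ m² and J ⊆ n² proper homogeneous ideals,
T = R ⊗_k S, F = I + J + mn. Then
Ass_T(T/F) = {p₁T + nT : p₁ ∈ Ass_R(R/I)} ∪ {p₂T + mT : p₂ ∈ Ass_S(S/J)}. -/

open MvPolynomial

noncomputable section

section Colon

variable {A : Type*} [CommRing A] [IsNoetherianRing A]

theorem mem_associatedPrimes_quotient_iff {K P : Ideal A} :
    P ∈ associatedPrimes A (A ⧸ K) ↔ P.IsPrime ∧ ∃ f, ∀ r, r ∈ P ↔ r * f ∈ K := by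
  rw [AssociatedPrimes.mem_iff, isAssociatedPrime_iff]
  refine and_congr_right fun _ ↦ ?_
  have key (f r : A) :
      r ∈ (⊥ : Submodule A (A ⧸ K)).colon {Ideal.Quotient.mk K f} ↔ r * f ∈ K := by
    rw [Submodule.mem_colon_singleton, Submodule.mem_bot, ← Ideal.Quotient.eq_zero_iff_mem,
      map_mul, Algebra.smul_def]
    rfl
  constructor
  · rintro ⟨x, rfl⟩
    obtain ⟨f, rfl⟩ := Ideal.Quotient.mk_surjective x
    exact ⟨f, key f⟩
  · rintro ⟨f, hf⟩
    exact ⟨Ideal.Quotient.mk K f, Ideal.ext fun r ↦ (hf r).trans (key f r).symm⟩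

/-- An associated prime of `A ⧸ I` is the annihilator of the class of an element of the maximal
ideal `m`, provided `I ≤ m ^ 2` and `m` is not idempotent. -/
theorem exists_mem_colon_of_mem_associatedPrimes {m I p : Ideal A} (hmax : m.IsMaximal)
    (hm : ¬ m ≤ m ^ 2) (hI : I ≤ m ^ 2) (hp : p ∈ associatedPrimes A (A ⧸ I)) :
    ∃ f ∈ m, ∀ r, r ∈ p ↔ r * f ∈ I := by
  obtain ⟨hprime, f, hf⟩ := mem_associatedPrimes_quotient_iff.1 hp
  by_cases hfm : f ∈ m
  · exact ⟨f, hfm, hf⟩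
  obtain ⟨c, i, hi, hci⟩ := hmax.exists_inv hfm
  obtain ⟨g, hgm, hgp⟩ : ∃ g ∈ m, g ∉ p := by
    by_contra! h
    refine hm fun x hx ↦ ?_
    have hx' : x = c * (x * f) + x * i := by linear_combination -x * hci
    rw [hx']
    refine add_mem (Ideal.mul_mem_left _ _ (hI ((hf x).1 (h x hx)))) ?_
    rw [pow_two]
    exact Ideal.mul_mem_mul hx hi
  refine ⟨g * f, Ideal.mul_mem_right _ _ hgm, fun r ↦ ?_⟩
  rw [← mul_assoc, ← hf (r * g)]
  exact ⟨fun h ↦ Ideal.mul_mem_right _ _ h, fun h ↦ (hprime.mem_or_mem h).resolve_right hgp⟩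

end Colon

section Retract

variable {R S T : Type*} [CommRing R] [CommRing S] [CommRing T]
  {i : R →+* T} {π : T →+* R} {j : S →+* T} {ρ : T →+* S}

theorem comap_eq_map_sup_ker_of_retract (hπi : ∀ r, π (i r) = r) (p : Ideal R) :
    p.comap π = p.map i ⊔ RingHom.ker π := by
  refine le_antisymm (fun t ht ↦ ?_) (sup_le ?_ (Ideal.ker_le_comap π))
  · rw [← add_sub_cancel (i (π t)) t]
    exact Submodule.add_mem_sup (Ideal.mem_map_of_mem i ht) (by simp [RingHom.mem_ker, hπi])
  · exact Ideal.map_le_iff_le_comap.2 fun r hr ↦ by simpa [hπi] using hr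

theorem map_inf_ker_le_mul_of_retract (hπi : ∀ r, π (i r) = r) (m : Ideal R) :
    m.map i ⊓ RingHom.ker π ≤ m.map i * RingHom.ker π := by
  have key (u : T) (hu : u ∈ m.map i) : u - i (π u) ∈ m.map i * RingHom.ker π := by
    induction hu using Submodule.span_induction with
    | mem x hx =>
      obtain ⟨r, -, rfl⟩ := hx
      simp [hπi]
    | zero => simp
    | add x y _ _ hx hy =>
      rw [map_add, map_add, add_sub_add_comm]
      exact add_mem hx hy
    | smul a x hxm hx =>
      have hax : a • x - i (π (a • x)) = x * (a - i (π a)) + i (π a) * (x - i (π x)) := by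
        rw [smul_eq_mul, map_mul, map_mul]
        ring
      rw [hax]
      refine add_mem (Ideal.mul_mem_mul hxm ?_) (Ideal.mul_mem_left _ _ hx)
      simp [RingHom.mem_ker, hπi]
  rintro u ⟨hu, hπu⟩
  simpa [RingHom.mem_ker.1 hπu] using key u hu

/-- The fiber product ideal is the intersection of the two contracted ideals. -/
theorem fiberProduct_eq_inf_comap {m I : Ideal R} {n J : Ideal S}
    (hπi : ∀ r, π (i r) = r) (hρj : ∀ s, ρ (j s) = s)
    (hπ : RingHom.ker π = n.map j) (hρ : RingHom.ker ρ = m.map i) (hI : I ≤ m) (hJ : J ≤ n) :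
    I.map i + J.map j + m.map i * n.map j = I.comap π ⊓ J.comap ρ := by
  have hi {r : R} (hr : r ∈ m) : ρ (i r) = 0 := by
    rw [← RingHom.mem_ker, hρ]
    exact Ideal.mem_map_of_mem i hr
  have hj {s : S} (hs : s ∈ n) : π (j s) = 0 := by
    rw [← RingHom.mem_ker, hπ]
    exact Ideal.mem_map_of_mem j hs
  simp only [Submodule.add_eq_sup]
  refine le_antisymm (sup_le (sup_le ?_ ?_) ?_) ?_
  · exact Ideal.map_le_iff_le_comap.2 fun r hr ↦ by simp [hπi, hi (hI hr), hr]
  · exact Ideal.map_le_iff_le_comap.2 fun s hs ↦ by simp [hρj, hj (hJ hs), hs]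
  · rw [← hπ, ← hρ]
    exact Ideal.mul_le_inf.trans (le_inf (inf_le_right.trans (Ideal.ker_le_comap π))
      (inf_le_left.trans (Ideal.ker_le_comap ρ)))
  · rintro t ⟨htI, htJ⟩
    have htI : π t ∈ I := htI
    have htJ : ρ t ∈ J := htJ
    have hu : t - i (π t) - j (ρ t) ∈ m.map i * n.map j := by
      rw [← hπ]
      refine map_inf_ker_le_mul_of_retract hπi m ⟨?_, ?_⟩
      · rw [← hρ]
        simp [RingHom.mem_ker, hρj, hi (hI htI)]
      · simp [RingHom.mem_ker, hπi, hj (hJ htJ)]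
    have ht : t = i (π t) + j (ρ t) + (t - i (π t) - j (ρ t)) := by ring
    rw [ht]
    exact Submodule.add_mem_sup (Submodule.add_mem_sup (Ideal.mem_map_of_mem i htI)
      (Ideal.mem_map_of_mem j htJ)) hu

variable [IsNoetherianRing R]

theorem mem_associatedPrimes_of_comap_eq {I : Ideal R} {P : Ideal T} {x : R}
    (hπ : Function.Surjective π) (hP : P.IsPrime)
    (hPx : (I.colon {x}).comap π = P) :
    I.colon {x} ∈ associatedPrimes R (R ⧸ I) := by
  subst hPx
  refine mem_associatedPrimes_quotient_iff.2
    ⟨?_, x, fun r ↦ by simp [Submodule.mem_colon_singleton]⟩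
  rw [← Ideal.map_comap_of_surjective π hπ (I.colon {x})]
  exact Ideal.map_isPrime_of_surjective hπ (Ideal.ker_le_comap π)

variable [IsNoetherianRing T]

theorem comap_mem_associatedPrimes_inf {m I p : Ideal R} {J : Ideal S}
    (hπi : ∀ r, π (i r) = r) (hρ : RingHom.ker ρ = m.map i) (hmax : m.IsMaximal)
    (hm : ¬ m ≤ m ^ 2) (hI : I ≤ m ^ 2) (hp : p ∈ associatedPrimes R (R ⧸ I)) :
    p.comap π ∈ associatedPrimes T (T ⧸ (I.comap π ⊓ J.comap ρ)) := by
  obtain ⟨f, hfm, hf⟩ := exists_mem_colon_of_mem_associatedPrimes hmax hm hI hp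
  have hprime := (mem_associatedPrimes_quotient_iff.1 hp).1
  have hif : ρ (i f) = 0 := by
    rw [← RingHom.mem_ker, hρ]
    exact Ideal.mem_map_of_mem i hfm
  exact mem_associatedPrimes_quotient_iff.2
    ⟨hprime.comap π, i f, fun t ↦ by simp [hf, hπi, hif]⟩

theorem associatedPrimes_inf_comap [IsNoetherianRing S] {m I : Ideal R} {n J : Ideal S}
    (hπi : ∀ r, π (i r) = r) (hρj : ∀ s, ρ (j s) = s)
    (hπ : RingHom.ker π = n.map j) (hρ : RingHom.ker ρ = m.map i)
    (hmmax : m.IsMaximal) (hnmax : n.IsMaximal) (hm : ¬ m ≤ m ^ 2) (hn : ¬ n ≤ n ^ 2)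
    (hI : I ≤ m ^ 2) (hJ : J ≤ n ^ 2) :
    associatedPrimes T (T ⧸ (I.comap π ⊓ J.comap ρ)) =
      Ideal.comap π '' associatedPrimes R (R ⧸ I) ∪
        Ideal.comap ρ '' associatedPrimes S (S ⧸ J) := by
  apply Set.Subset.antisymm
  · intro P hP
    obtain ⟨hprime, t, ht⟩ := mem_associatedPrimes_quotient_iff.1 hP
    have hPt : P = (I.colon {π t}).comap π ⊓ (J.colon {ρ t}).comap ρ :=
      Ideal.ext fun r ↦ by simp [ht, Submodule.mem_colon_singleton]
    rcases hprime.inf_le.1 hPt.ge with h | h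
    · have h' := h.antisymm (hPt.trans_le inf_le_left)
      exact Or.inl ⟨_, mem_associatedPrimes_of_comap_eq (fun r ↦ ⟨i r, hπi r⟩) hprime h', h'⟩
    · have h' := h.antisymm (hPt.trans_le inf_le_right)
      exact Or.inr ⟨_, mem_associatedPrimes_of_comap_eq (fun s ↦ ⟨j s, hρj s⟩) hprime h', h'⟩
  · rintro _ (⟨p, hp, rfl⟩ | ⟨q, hq, rfl⟩)
    · exact comap_mem_associatedPrimes_inf hπi hρ hmmax hm hI hp
    · rw [inf_comm]
      exact comap_mem_associatedPrimes_inf hρj hπ hnmax hn hJ hq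

end Retract

section Polynomial

variable (k : Type*) [Field k] {σ τ : Type*}

theorem mxI_eq_ker_constantCoeff :
    mxI k σ = RingHom.ker (constantCoeff : MvPolynomial σ k →+* k) := by
  refine le_antisymm (Ideal.span_le.2 ?_) fun f hf ↦ ?_
  · rintro _ ⟨s, rfl⟩
    simp
  · rw [mxI, ← Set.image_univ, mem_ideal_span_X_image]
    intro d hd
    by_contra! h
    have : d = 0 := Finsupp.ext fun s ↦ by simpa using h s
    subst this
    exact mem_support_iff.1 hd hf

theorem mxI_isMaximal : (mxI k σ).IsMaximal := by
  rw [mxI_eq_ker_constantCoeff]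
  exact RingHom.ker_isMaximal_of_surjective _ fun c ↦ ⟨C c, constantCoeff_C σ c⟩

theorem not_mxI_le_sq [Nonempty σ] : ¬ mxI k σ ≤ mxI k σ ^ 2 := by
  intro h
  obtain ⟨s⟩ := ‹Nonempty σ›
  have hs : (X s : MvPolynomial σ k) ∈ idealOfVars σ k ^ 2 := h (Ideal.subset_span ⟨s, rfl⟩)
  rw [mem_pow_idealOfVars_iff'] at hs
  simpa using hs (Finsupp.single s 1) (by simp)

variable {k}

/-- The kernel of an algebra retraction killing the variables in the image of `j` is the
extension of the maximal ideal along `j`. -/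
theorem ker_eq_map_mxI {ι : Type*} {i : σ → ι} {j : τ → ι}
    (hij : ∀ x, (∃ s, i s = x) ∨ ∃ t, j t = x)
    (π : MvPolynomial ι k →ₐ[k] MvPolynomial σ k)
    (hπi : ∀ s, π (X (i s)) = X s) (hπj : ∀ t, π (X (j t)) = 0) :
    RingHom.ker (π : MvPolynomial ι k →+* MvPolynomial σ k) =
      (mxI k τ).map (rename j : MvPolynomial τ k →ₐ[k] MvPolynomial ι k).toRingHom := by
  set N := (mxI k τ).map (rename j : MvPolynomial τ k →ₐ[k] MvPolynomial ι k).toRingHom with hN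
  have hX (t : τ) : X (j t) ∈ N := by
    simpa [hN, mxI] using Ideal.mem_map_of_mem (rename j : MvPolynomial τ k →ₐ[k] _).toRingHom
      (Ideal.subset_span ⟨t, rfl⟩ : X t ∈ mxI k τ)
  refine le_antisymm (fun f hf ↦ ?_) ?_
  · have key : ((Ideal.Quotient.mkₐ k N).comp (rename i)).comp π = Ideal.Quotient.mkₐ k N := by
      refine algHom_ext fun x ↦ ?_
      rcases hij x with ⟨s, rfl⟩ | ⟨t, rfl⟩
      · simp [hπi]
      · simpa [hπj] using (Ideal.Quotient.eq_zero_iff_mem.2 (hX t)).symm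
    have hf' : π f = 0 := hf
    rw [← Ideal.Quotient.eq_zero_iff_mem]
    simpa [hf'] using (DFunLike.congr_fun key f).symm
  · rw [hN, Ideal.map_le_iff_le_comap, mxI, Ideal.span_le]
    rintro _ ⟨t, rfl⟩
    simp [hπj]

end Polynomial

theorem associatedPrimes_fiberProduct
    (k : Type*) [Field k] (a b : ℕ) (ha : 0 < a) (hb : 0 < b)
    (I : Ideal (MvPolynomial (Fin a) k)) (hIm : I ≤ mxI k (Fin a) ^ 2)
    (hIproper : I ≠ ⊤) (hIhom : IsHomogIdeal I)
    (J : Ideal (MvPolynomial (Fin b) k)) (hJn : J ≤ mxI k (Fin b) ^ 2)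
    (hJproper : J ≠ ⊤) (hJhom : IsHomogIdeal J)
    (I' J' m' n' : Ideal (MvPolynomial (Fin a ⊕ Fin b) k))
    (hI' : I' = Ideal.map (rename (Sum.inl : Fin a → Fin a ⊕ Fin b) :
      MvPolynomial (Fin a) k →ₐ[k] MvPolynomial (Fin a ⊕ Fin b) k) I)
    (hJ' : J' = Ideal.map (rename (Sum.inr : Fin b → Fin a ⊕ Fin b) :
      MvPolynomial (Fin b) k →ₐ[k] MvPolynomial (Fin a ⊕ Fin b) k) J)
    (hm' : m' = Ideal.map (rename (Sum.inl : Fin a → Fin a ⊕ Fin b) :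
      MvPolynomial (Fin a) k →ₐ[k] MvPolynomial (Fin a ⊕ Fin b) k) (mxI k (Fin a)))
    (hn' : n' = Ideal.map (rename (Sum.inr : Fin b → Fin a ⊕ Fin b) :
      MvPolynomial (Fin b) k →ₐ[k] MvPolynomial (Fin a ⊕ Fin b) k) (mxI k (Fin b)))
    (F : Ideal (MvPolynomial (Fin a ⊕ Fin b) k)) (hF : F = I' + J' + m' * n') :
    associatedPrimes (MvPolynomial (Fin a ⊕ Fin b) k)
        (MvPolynomial (Fin a ⊕ Fin b) k ⧸ F) =
      ((fun p => Ideal.map (rename (Sum.inl : Fin a → Fin a ⊕ Fin b) :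
          MvPolynomial (Fin a) k →ₐ[k] MvPolynomial (Fin a ⊕ Fin b) k) p + n') ''
        associatedPrimes (MvPolynomial (Fin a) k) (MvPolynomial (Fin a) k ⧸ I)) ∪
      ((fun q => Ideal.map (rename (Sum.inr : Fin b → Fin a ⊕ Fin b) :
          MvPolynomial (Fin b) k →ₐ[k] MvPolynomial (Fin a ⊕ Fin b) k) q + m') ''
        associatedPrimes (MvPolynomial (Fin b) k) (MvPolynomial (Fin b) k ⧸ J)) := by
  subst hI' hJ' hm' hn' hF
  have : Nonempty (Fin a) := ⟨⟨0, ha⟩⟩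
  have : Nonempty (Fin b) := ⟨⟨0, hb⟩⟩
  let i : MvPolynomial (Fin a) k →ₐ[k] MvPolynomial (Fin a ⊕ Fin b) k := rename Sum.inl
  let j : MvPolynomial (Fin b) k →ₐ[k] MvPolynomial (Fin a ⊕ Fin b) k := rename Sum.inr
  let π : MvPolynomial (Fin a ⊕ Fin b) k →ₐ[k] MvPolynomial (Fin a) k := aeval (Sum.elim X 0)
  let ρ : MvPolynomial (Fin a ⊕ Fin b) k →ₐ[k] MvPolynomial (Fin b) k := aeval (Sum.elim 0 X)
  have hπi (f) : π (i f) = f :=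
    DFunLike.congr_fun (algHom_ext (f := π.comp i) (g := .id k _) fun s ↦ by simp [π, i]) f
  have hρj (f) : ρ (j f) = f :=
    DFunLike.congr_fun (algHom_ext (f := ρ.comp j) (g := .id k _) fun t ↦ by simp [ρ, j]) f
  have hπ : RingHom.ker π.toRingHom = (mxI k (Fin b)).map j.toRingHom :=
    ker_eq_map_mxI (i := Sum.inl) (fun x ↦ by cases x <;> simp) π
      (fun s ↦ by simp [π]) (fun t ↦ by simp [π])
  have hρ : RingHom.ker ρ.toRingHom = (mxI k (Fin a)).map i.toRingHom :=
    ker_eq_map_mxI (i := Sum.inr) (fun x ↦ by cases x <;> simp) ρ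
      (fun s ↦ by simp [ρ]) (fun t ↦ by simp [ρ])
  have hF : I.map i.toRingHom + J.map j.toRingHom +
      (mxI k (Fin a)).map i.toRingHom * (mxI k (Fin b)).map j.toRingHom =
        I.comap π.toRingHom ⊓ J.comap ρ.toRingHom :=
    fiberProduct_eq_inf_comap hπi hρj hπ hρ (hIm.trans (Ideal.pow_le_self two_ne_zero))
      (hJn.trans (Ideal.pow_le_self two_ne_zero))
  have hAss := associatedPrimes_inf_comap hπi hρj hπ hρ (mxI_isMaximal k) (mxI_isMaximal k)
    (not_mxI_le_sq k) (not_mxI_le_sq k) hIm hJn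
  have hcπ : Ideal.comap π.toRingHom =
      fun p ↦ p.map i.toRingHom + (mxI k (Fin b)).map j.toRingHom :=
    funext fun p ↦ by rw [comap_eq_map_sup_ker_of_retract hπi, hπ, Submodule.add_eq_sup]
  have hcρ : Ideal.comap ρ.toRingHom =
      fun q ↦ q.map j.toRingHom + (mxI k (Fin a)).map i.toRingHom :=
    funext fun q ↦ by rw [comap_eq_map_sup_ker_of_retract hρj, hρ, Submodule.add_eq_sup]
  rw [← hF, hcπ, hcρ] at hAss
  exact hAss

end
end

section
/- Let k be a field, let R and S be polynomial rings over k in at least one variable each, with graded maximal ideals m and n, and let T = R ⊗_k S. Let K_0 ⊇ K_1 ⊇ K_2 ⊇ ⋯ be a descending chain of homogeneous ideals of R and L_0 ⊇ L_1 ⊇ L_2 ⊇ ⋯ a descending chain of homogeneous ideals of S. Then for every integer s ≥ 1, one has in T: (Σ_{i=0}^{s} K_i n^{s-i}) ∩ (Σ_{t=0}^{s} L_t m^{s-t}) = Σ_{i=0}^{s} Σ_{t=0}^{s} (K_i ∩ m^{s-t})(L_t ∩ n^{s-i}). -/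
/- STATEMENT 12: k a field, R and S polynomial rings over k in at least one variable each
with graded maximal ideals m and n, T = R ⊗_k S. Let K_0 ⊇ K_1 ⊇ ⋯ and L_0 ⊇ L_1 ⊇ ⋯
be descending chains of homogeneous ideals of R and S respectively. Then for s ≥ 1, in T:
(Σ_{i=0}^{s} K_i n^{s-i}) ∩ (Σ_{t=0}^{s} L_t m^{s-t})
  = Σ_{i=0}^{s} Σ_{t=0}^{s} (K_i ∩ m^{s-t})(L_t ∩ n^{s-i}). -/

open MvPolynomial

noncomputable section

section RenameProducts

variable {k : Type*} [Field k] {σ τ : Type*}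

theorem span_rename_mul_rename_eq_top :
    Submodule.span k {x | ∃ (u : MvPolynomial σ k) (v : MvPolynomial τ k),
      rename Sum.inl u * rename Sum.inr v = x} = (⊤ : Submodule k (MvPolynomial (σ ⊕ τ) k)) := by
  rw [eq_top_iff]
  intro f _
  induction f using MvPolynomial.induction_on with
  | C a => exact Submodule.subset_span ⟨C a, 1, by simp⟩
  | add p q hp hq => exact add_mem (hp trivial) (hq trivial)
  | mul_X p i hp =>
    refine Submodule.span_induction (p := fun x _ => x * X i ∈ _) ?_ ?_ ?_ ?_ (hp trivial)
    · rintro _ ⟨u, v, rfl⟩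
      rcases i with i | i
      · exact Submodule.subset_span ⟨u * X i, v, by simp only [map_mul, rename_X]; ring⟩
      · exact Submodule.subset_span ⟨u, v * X i, by simp only [map_mul, rename_X]; ring⟩
    · simp
    · intro x y _ _ hx hy
      rw [add_mul]
      exact add_mem hx hy
    · intro c x _ hx
      rw [smul_mul_assoc]
      exact Submodule.smul_mem _ _ hx

/-- The extension to the polynomial ring in the variables `σ ⊕ τ` of an ideal of the polynomial
ring in the variables `σ`. -/
abbrev extendLeft (τ : Type*) (U : Ideal (MvPolynomial σ k)) : Ideal (MvPolynomial (σ ⊕ τ) k) :=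
  U.map (rename (Sum.inl : σ → σ ⊕ τ) : MvPolynomial σ k →ₐ[k] MvPolynomial (σ ⊕ τ) k)

/-- The extension to the polynomial ring in the variables `σ ⊕ τ` of an ideal of the polynomial
ring in the variables `τ`. -/
abbrev extendRight (σ : Type*) (V : Ideal (MvPolynomial τ k)) : Ideal (MvPolynomial (σ ⊕ τ) k) :=
  V.map (rename (Sum.inr : τ → σ ⊕ τ) : MvPolynomial τ k →ₐ[k] MvPolynomial (σ ⊕ τ) k)

theorem extendLeft_mul_extendRight_induction {U : Ideal (MvPolynomial σ k)}
    {V : Ideal (MvPolynomial τ k)} {p : MvPolynomial (σ ⊕ τ) k → Prop}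
    (mul : ∀ u ∈ U, ∀ v ∈ V, p (rename Sum.inl u * rename Sum.inr v))
    (zero : p 0) (add : ∀ x y, p x → p y → p (x + y)) {f : MvPolynomial (σ ⊕ τ) k}
    (hf : f ∈ extendLeft τ U * extendRight σ V) : p f := by
  have mul_left : ∀ c : MvPolynomial (σ ⊕ τ) k, ∀ u ∈ U, ∀ v ∈ V,
      p (c * (rename Sum.inl u * rename Sum.inr v)) := by
    intro c
    have hc : c ∈ Submodule.span k {x | ∃ (u : MvPolynomial σ k) (v : MvPolynomial τ k),
        rename Sum.inl u * rename Sum.inr v = x} := by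
      rw [span_rename_mul_rename_eq_top]
      trivial
    induction hc using Submodule.span_induction with
    | mem c hc =>
      obtain ⟨u', v', rfl⟩ := hc
      intro u hu v hv
      rw [mul_mul_mul_comm, ← map_mul, ← map_mul]
      exact mul _ (U.mul_mem_left u' hu) _ (V.mul_mem_left v' hv)
    | zero => simpa using fun _ _ _ _ => zero
    | add c d _ _ hc hd =>
      intro u hu v hv
      rw [add_mul]
      exact add _ _ (hc u hu v hv) (hd u hu v hv)
    | smul r c _ hc =>
      intro u hu v hv
      rw [smul_mul_assoc, ← mul_smul_comm, ← smul_mul_assoc, ← map_smul]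
      exact hc _ (Submodule.smul_of_tower_mem U r hu) v hv
  rw [extendLeft, extendRight, Ideal.map, Ideal.map, Ideal.span_mul_span'] at hf
  suffices h : ∀ c, p (c * f) by simpa using h 1
  induction hf using Submodule.span_induction with
  | mem x hx =>
    obtain ⟨_, ⟨u, hu, rfl⟩, _, ⟨v, hv, rfl⟩, rfl⟩ := hx
    exact fun c => mul_left c u hu v hv
  | zero => simpa using zero
  | add x y _ _ hx hy =>
    intro c
    rw [mul_add]
    exact add _ _ (hx c) (hy c)
  | smul r x _ hx =>
    intro c
    rw [smul_eq_mul, ← mul_assoc]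
    exact hx _

/-- The linear endomorphism `φ ⊗ ψ` of the polynomial ring in the variables `σ ⊕ τ`. -/
def tensorEnd (φ : MvPolynomial σ k →ₗ[k] MvPolynomial σ k)
    (ψ : MvPolynomial τ k →ₗ[k] MvPolynomial τ k) :
    MvPolynomial (σ ⊕ τ) k →ₗ[k] MvPolynomial (σ ⊕ τ) k :=
  (tensorEquivSum k σ τ k).toLinearMap ∘ₗ TensorProduct.map φ ψ ∘ₗ
    (tensorEquivSum k σ τ k).symm.toLinearMap

theorem tensorEquivSum_tmul (u : MvPolynomial σ k) (v : MvPolynomial τ k) :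
    tensorEquivSum k σ τ k (u ⊗ₜ v) = rename Sum.inl u * rename Sum.inr v := by
  have hu : (tensorEquivSum k σ τ k).toAlgHom.comp Algebra.TensorProduct.includeLeft =
      rename Sum.inl := by ext; simp
  have hv : (tensorEquivSum k σ τ k).toAlgHom.comp Algebra.TensorProduct.includeRight =
      rename Sum.inr := by ext; simp
  rw [← hu, ← hv]
  simp [← map_mul]

theorem tensorEnd_rename_mul_rename (φ : MvPolynomial σ k →ₗ[k] MvPolynomial σ k)
    (ψ : MvPolynomial τ k →ₗ[k] MvPolynomial τ k)
    (u : MvPolynomial σ k) (v : MvPolynomial τ k) :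
    tensorEnd φ ψ (rename Sum.inl u * rename Sum.inr v) =
      rename Sum.inl (φ u) * rename Sum.inr (ψ v) := by
  simp [tensorEnd, ← tensorEquivSum_tmul]

theorem rename_mul_rename_mem {U : Ideal (MvPolynomial σ k)} {V : Ideal (MvPolynomial τ k)}
    {u : MvPolynomial σ k} {v : MvPolynomial τ k} (hu : u ∈ U) (hv : v ∈ V) :
    rename Sum.inl u * rename Sum.inr v ∈ extendLeft τ U * extendRight σ V :=
  Ideal.mul_mem_mul (Ideal.mem_map_of_mem _ hu) (Ideal.mem_map_of_mem _ hv)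

theorem tensorEnd_mem {φ : MvPolynomial σ k →ₗ[k] MvPolynomial σ k}
    {ψ : MvPolynomial τ k →ₗ[k] MvPolynomial τ k} {U : Ideal (MvPolynomial σ k)}
    {V : Ideal (MvPolynomial τ k)} {J : Ideal (MvPolynomial (σ ⊕ τ) k)}
    (h : ∀ u ∈ U, ∀ v ∈ V, rename Sum.inl (φ u) * rename Sum.inr (ψ v) ∈ J)
    {f : MvPolynomial (σ ⊕ τ) k} (hf : f ∈ extendLeft τ U * extendRight σ V) :
    tensorEnd φ ψ f ∈ J := by
  refine extendLeft_mul_extendRight_induction (p := fun f => tensorEnd φ ψ f ∈ J) ?_ ?_ ?_ hf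
  · intro u hu v hv
    rw [tensorEnd_rename_mul_rename]
    exact h u hu v hv
  · simp
  · intro x y hx hy
    rw [map_add]
    exact add_mem hx hy

theorem extendLeft_top : extendLeft τ (⊤ : Ideal (MvPolynomial σ k)) = ⊤ :=
  Ideal.map_top _

theorem extendRight_top : extendRight σ (⊤ : Ideal (MvPolynomial τ k)) = ⊤ :=
  Ideal.map_top _

theorem extendLeft_inf_extendRight (U : Ideal (MvPolynomial σ k)) (V : Ideal (MvPolynomial τ k)) :
    extendLeft τ U ⊓ extendRight σ V = extendLeft τ U * extendRight σ V := by
  refine le_antisymm ?_ Ideal.mul_le_inf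
  rintro f ⟨hU, hV⟩
  obtain ⟨g, hg⟩ := (U.restrictScalars k).subtype.exists_leftInverse_of_injective
    (Submodule.ker_subtype _)
  let π := (U.restrictScalars k).subtype ∘ₗ g
  have hπ : ∀ u ∈ U, π u = u := fun u hu =>
    congrArg Subtype.val (LinearMap.congr_fun hg ⟨u, hu⟩)
  have hfix : tensorEnd π LinearMap.id f = f := by
    rw [SetLike.mem_coe, ← Ideal.mul_top (extendLeft τ U), ← extendRight_top] at hU
    refine extendLeft_mul_extendRight_induction
      (p := fun f => tensorEnd π LinearMap.id f = f) ?_ ?_ ?_ hU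
    · intro u hu v _
      rw [tensorEnd_rename_mul_rename, hπ u hu, LinearMap.id_apply]
    · simp
    · intro x y hx hy
      rw [map_add, hx, hy]
  rw [← hfix]
  rw [SetLike.mem_coe, ← Ideal.top_mul (extendRight σ V), ← extendLeft_top] at hV
  exact tensorEnd_mem (fun u _ v hv => rename_mul_rename_mem (g u).2 hv) hV

/-- The component of bidegree `(p, q)` of a polynomial in the variables `σ ⊕ τ`. -/
abbrev bihomogeneousComponent (p q : ℕ) :
    MvPolynomial (σ ⊕ τ) k →ₗ[k] MvPolynomial (σ ⊕ τ) k :=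
  tensorEnd (homogeneousComponent p) (homogeneousComponent q)

theorem bihomogeneousComponent_idem (p q : ℕ) (f : MvPolynomial (σ ⊕ τ) k) :
    bihomogeneousComponent p q (bihomogeneousComponent p q f) = bihomogeneousComponent p q f := by
  have hf : f ∈ extendLeft τ (⊤ : Ideal (MvPolynomial σ k)) * extendRight σ ⊤ := by
    simp [extendLeft_top, extendRight_top]
  refine extendLeft_mul_extendRight_induction (p := fun f => bihomogeneousComponent p q
    (bihomogeneousComponent p q f) = bihomogeneousComponent p q f) ?_ ?_ ?_ hf
  · intro u _ v _
    simp only [tensorEnd_rename_mul_rename,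
      homogeneousComponent_eq_self (homogeneousComponent_isHomogeneous _ _)]
  · simp
  · intro x y hx hy
    simp only [map_add, hx, hy]

theorem sum_range_homogeneousComponent {u : MvPolynomial σ k} {N : ℕ} (h : u.totalDegree < N) :
    ∑ p ∈ Finset.range N, homogeneousComponent p u = u := by
  conv_rhs => rw [← sum_homogeneousComponent u]
  refine (Finset.sum_subset (by simpa using h) ?_).symm
  intro p _ hp
  exact homogeneousComponent_eq_zero _ _ (by simpa [Nat.lt_succ_iff] using hp)

theorem exists_sum_bihomogeneousComponent (f : MvPolynomial (σ ⊕ τ) k) :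
    ∃ N, ∀ M ≥ N, ∑ p ∈ Finset.range M, ∑ q ∈ Finset.range M,
      bihomogeneousComponent p q f = f := by
  have hf : f ∈ extendLeft τ (⊤ : Ideal (MvPolynomial σ k)) * extendRight σ ⊤ := by
    simp [extendLeft_top, extendRight_top]
  refine extendLeft_mul_extendRight_induction (p := fun f => ∃ N, ∀ M ≥ N,
    ∑ p ∈ Finset.range M, ∑ q ∈ Finset.range M, bihomogeneousComponent p q f = f) ?_ ?_ ?_ hf
  · intro u _ v _
    refine ⟨max u.totalDegree v.totalDegree + 1, fun M hM => ?_⟩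
    simp only [tensorEnd_rename_mul_rename]
    rw [← Finset.sum_mul_sum, ← map_sum, ← map_sum, sum_range_homogeneousComponent (by omega),
      sum_range_homogeneousComponent (by omega)]
  · simp
  · rintro x y ⟨N, hN⟩ ⟨N', hN'⟩
    refine ⟨max N N', fun M hM => ?_⟩
    simp only [map_add, Finset.sum_add_distrib]
    rw [hN M (by omega), hN' M (by omega)]

theorem mem_of_bihomogeneousComponent_mem {J : Ideal (MvPolynomial (σ ⊕ τ) k)}
    {f : MvPolynomial (σ ⊕ τ) k} (h : ∀ p q, bihomogeneousComponent p q f ∈ J) : f ∈ J := by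
  obtain ⟨N, hN⟩ := exists_sum_bihomogeneousComponent f
  rw [← hN N le_rfl]
  exact sum_mem fun p _ => sum_mem fun q _ => h p q

theorem mxI_eq_idealOfVars : mxI k σ = idealOfVars σ k := rfl

theorem homogeneousComponent_mem_mxI_pow {p d : ℕ} (h : d ≤ p) (u : MvPolynomial σ k) :
    homogeneousComponent p u ∈ mxI k σ ^ d := by
  rw [mxI_eq_idealOfVars, mem_pow_idealOfVars_iff']
  intro x hx
  rw [coeff_homogeneousComponent, if_neg (by omega)]

theorem homogeneousComponent_eq_zero_of_mem_mxI_pow {p d : ℕ} (h : p < d)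
    {u : MvPolynomial σ k} (hu : u ∈ mxI k σ ^ d) : homogeneousComponent p u = 0 := by
  rw [mxI_eq_idealOfVars, mem_pow_idealOfVars_iff'] at hu
  ext x
  rw [coeff_homogeneousComponent]
  split_ifs with hx
  · exact hu x (by omega)
  · simp

theorem bihomogeneousComponent_mem_extendLeft {K : ℕ → Ideal (MvPolynomial σ k)}
    (hK : Antitone K) (hKhom : ∀ i, IsHomogIdeal (K i)) {s : ℕ} {f : MvPolynomial (σ ⊕ τ) k}
    (hf : f ∈ ⨆ i ∈ Finset.range (s + 1), extendLeft τ (K i) * extendRight σ (mxI k τ) ^ (s - i))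
    (p q : ℕ) : bihomogeneousComponent p q f ∈ extendLeft τ (K (s - q)) := by
  obtain ⟨g, rfl⟩ := (Submodule.mem_iSup_finset_iff_exists_sum _ _).mp hf
  rw [map_sum]
  refine sum_mem fun i _ => ?_
  have hg : (g i : MvPolynomial (σ ⊕ τ) k) ∈
      extendLeft τ (K i) * extendRight σ (mxI k τ ^ (s - i)) := by
    rw [extendRight, Ideal.map_pow]
    exact (g i).2
  refine tensorEnd_mem (fun u hu v hv => ?_) hg
  rcases lt_or_ge q (s - i) with h | h
  · simp [homogeneousComponent_eq_zero_of_mem_mxI_pow h hv]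
  · exact Ideal.mul_mem_right _ _
      (Ideal.mem_map_of_mem _ (hK (by omega) (hKhom i u hu p)))

theorem bihomogeneousComponent_mem_extendRight {L : ℕ → Ideal (MvPolynomial τ k)}
    (hL : Antitone L) (hLhom : ∀ t, IsHomogIdeal (L t)) {s : ℕ} {f : MvPolynomial (σ ⊕ τ) k}
    (hf : f ∈ ⨆ t ∈ Finset.range (s + 1), extendRight σ (L t) * extendLeft τ (mxI k σ) ^ (s - t))
    (p q : ℕ) : bihomogeneousComponent p q f ∈ extendRight σ (L (s - p)) := by
  obtain ⟨g, rfl⟩ := (Submodule.mem_iSup_finset_iff_exists_sum _ _).mp hf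
  rw [map_sum]
  refine sum_mem fun t _ => ?_
  have hg : (g t : MvPolynomial (σ ⊕ τ) k) ∈
      extendLeft τ (mxI k σ ^ (s - t)) * extendRight σ (L t) := by
    rw [extendLeft, Ideal.map_pow, mul_comm]
    exact (g t).2
  refine tensorEnd_mem (fun u hu v hv => ?_) hg
  rcases lt_or_ge p (s - t) with h | h
  · simp [homogeneousComponent_eq_zero_of_mem_mxI_pow h hu]
  · exact Ideal.mul_mem_left _ _
      (Ideal.mem_map_of_mem _ (hL (by omega) (hLhom t v hv q)))

end RenameProducts

theorem intersection_of_filtration_sums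
    (k : Type*) [Field k] (a b : ℕ) (ha : 0 < a) (hb : 0 < b)
    (K : ℕ → Ideal (MvPolynomial (Fin a) k)) (hKdesc : ∀ i : ℕ, K (i + 1) ≤ K i)
    (hKhom : ∀ i : ℕ, IsHomogIdeal (K i))
    (L : ℕ → Ideal (MvPolynomial (Fin b) k)) (hLdesc : ∀ t : ℕ, L (t + 1) ≤ L t)
    (hLhom : ∀ t : ℕ, IsHomogIdeal (L t))
    (m' n' : Ideal (MvPolynomial (Fin a ⊕ Fin b) k))
    (hm' : m' = Ideal.map (rename (Sum.inl : Fin a → Fin a ⊕ Fin b) :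
      MvPolynomial (Fin a) k →ₐ[k] MvPolynomial (Fin a ⊕ Fin b) k) (mxI k (Fin a)))
    (hn' : n' = Ideal.map (rename (Sum.inr : Fin b → Fin a ⊕ Fin b) :
      MvPolynomial (Fin b) k →ₐ[k] MvPolynomial (Fin a ⊕ Fin b) k) (mxI k (Fin b)))
    -- the extensions of the filtrations to `T`
    (K' : ℕ → Ideal (MvPolynomial (Fin a ⊕ Fin b) k))
    (hK' : ∀ i : ℕ, K' i = Ideal.map (rename (Sum.inl : Fin a → Fin a ⊕ Fin b) :
      MvPolynomial (Fin a) k →ₐ[k] MvPolynomial (Fin a ⊕ Fin b) k) (K i))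
    (L' : ℕ → Ideal (MvPolynomial (Fin a ⊕ Fin b) k))
    (hL' : ∀ t : ℕ, L' t = Ideal.map (rename (Sum.inr : Fin b → Fin a ⊕ Fin b) :
      MvPolynomial (Fin b) k →ₐ[k] MvPolynomial (Fin a ⊕ Fin b) k) (L t))
    (s : ℕ) (hs : 1 ≤ s) :
    (⨆ i ∈ Finset.range (s + 1), K' i * n' ^ (s - i)) ⊓
        (⨆ t ∈ Finset.range (s + 1), L' t * m' ^ (s - t)) =
      ⨆ i ∈ Finset.range (s + 1), ⨆ t ∈ Finset.range (s + 1),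
        (K' i ⊓ m' ^ (s - t)) * (L' t ⊓ n' ^ (s - i)) := by
  subst hm' hn'
  obtain rfl : K' = fun i => extendLeft (Fin b) (K i) := funext hK'
  obtain rfl : L' = fun t => extendRight (Fin a) (L t) := funext hL'
  refine le_antisymm ?_ ?_
  · rintro f ⟨hfK, hfL⟩
    refine mem_of_bihomogeneousComponent_mem fun p q => ?_
    have hmem := Submodule.mem_inf.mpr
      ⟨bihomogeneousComponent_mem_extendLeft (antitone_nat_of_succ_le hKdesc) hKhom hfK p q,
        bihomogeneousComponent_mem_extendRight (antitone_nat_of_succ_le hLdesc) hLhom hfL p q⟩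
    rw [extendLeft_inf_extendRight] at hmem
    rw [← bihomogeneousComponent_idem]
    refine tensorEnd_mem (fun u hu v hv => ?_) hmem
    refine Submodule.mem_iSup_of_mem (s - q) (Submodule.mem_iSup_of_mem (by simp)
      (Submodule.mem_iSup_of_mem (s - p) (Submodule.mem_iSup_of_mem (by simp) ?_)))
    refine Ideal.mul_mem_mul ⟨Ideal.mem_map_of_mem _ (hKhom _ u hu p), ?_⟩
      ⟨Ideal.mem_map_of_mem _ (hLhom _ v hv q), ?_⟩
    · rw [SetLike.mem_coe, ← Ideal.map_pow]
      exact Ideal.mem_map_of_mem _ (homogeneousComponent_mem_mxI_pow (by omega) u)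
    · rw [SetLike.mem_coe, ← Ideal.map_pow]
      exact Ideal.mem_map_of_mem _ (homogeneousComponent_mem_mxI_pow (by omega) v)
  · refine iSup₂_le fun i hi => iSup₂_le fun t ht => le_inf ?_ ?_
    · exact (Ideal.mul_mono inf_le_left inf_le_right).trans
        (le_iSup₂_of_le (f := fun i (_ : i ∈ Finset.range (s + 1)) =>
          extendLeft (Fin b) (K i) * extendRight (Fin a) (mxI k (Fin b)) ^ (s - i)) i hi le_rfl)
    · rw [mul_comm]
      exact (Ideal.mul_mono inf_le_left inf_le_right).trans
        (le_iSup₂_of_le (f := fun t (_ : t ∈ Finset.range (s + 1)) =>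
          extendRight (Fin a) (L t) * extendLeft (Fin b) (mxI k (Fin a)) ^ (s - t)) t ht le_rfl)

end
end
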